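/- arXiv:1401.4313 — 6 statements merged into one kernel-verified Lean document; each statement's English description precedes it below -/
import Mathlib

section
/- Let 𝔽_Q be a finite field with Q ≥ 2 elements and let 0 < γ ≤ 1 − 1/Q. Let A_1, …, A_N be independent 𝔽_Q-valued random variables, each taking the value 0 with probability 1 − γ and each of the Q − 1 nonzero elements of 𝔽_Q with probability γ/(Q−1). Let μ ∈ 𝔽_Q^N be a fixed vector with exactly d₁ ≥ 1 nonzero coordinates. Then Pr(∑_{i=1}^N A_i μ_i = 0) = Q^{-1} + (1 − γ/(1−Q^{-1}))^{d₁} (1 − Q^{-1}), and for every nonzero q ∈ 𝔽_Q, Pr(∑_{i=1}^N A_i μ_i = q) = Q^{-1} − (1 − γ/(1−Q^{-1}))^{d₁} Q^{-1}. -/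
open MeasureTheory

/-- If finitely many fibers of `X` have outer probabilities adding up to `1`, then the probability
of any event determined by `X` is the sum over the fibers it contains, even if `X` is not
measurable. -/
theorem measure_setOf_comp_eq_sum {Ω ι : Type*} [MeasurableSpace Ω] (P : Measure Ω)
    [IsProbabilityMeasure P] [Fintype ι] (X : Ω → ι)
    (hsum : ∑ a, P {ω | X ω = a} = 1) (p : ι → Prop) [DecidablePred p] :
    P {ω | p (X ω)} = ∑ a, if p a then P {ω | X ω = a} else 0 := by
  have upper : ∀ (r : ι → Prop) [DecidablePred r],
      P {ω | r (X ω)} ≤ ∑ a, if r a then P {ω | X ω = a} else 0 := by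
    intro r _
    rw [← Finset.sum_filter]
    refine le_trans (measure_mono ?_) (measure_biUnion_finset_le _ _)
    intro ω hω
    simpa using hω
  have hle := upper (fun a => ¬ p a)
  have hsplit : (∑ a, if p a then P {ω | X ω = a} else 0)
      + (∑ a, if ¬ p a then P {ω | X ω = a} else 0) = 1 := by
    rw [← Finset.sum_add_distrib, ← hsum]
    refine Finset.sum_congr rfl fun a _ => ?_
    by_cases h : p a <;> simp [h]
  have hone : 1 ≤ P {ω | p (X ω)} + P {ω | ¬ p (X ω)} := by
    rw [← measure_univ (μ := P)]
    refine le_trans (measure_mono ?_) (measure_union_le _ _)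
    intro ω _
    exact em _
  refine le_antisymm (upper p) ?_
  have hfin : (∑ a, if ¬ p a then P {ω | X ω = a} else 0) ≠ ⊤ := by
    refine ne_top_of_le_ne_top ENNReal.one_ne_top ?_
    rw [← hsplit]
    exact le_add_self
  refine (ENNReal.add_le_add_iff_right hfin).1 ?_
  rw [hsplit]
  exact hone.trans (by gcongr)

/-- The point masses of the sparsity model with parameter `γ`. -/
noncomputable def sparseWeight (F : Type*) [Field F] [Fintype F] [DecidableEq F] (γ : ℝ) (a : F) :
    ℝ :=
  if a = 0 then 1 - γ else γ / ((Fintype.card F : ℝ) - 1)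

section SparseWeight

variable {F : Type*} [Field F] [Fintype F] [DecidableEq F]

theorem sum_sparseWeight (γ : ℝ) : ∑ a : F, sparseWeight F γ a = 1 := by
  have hcard : (1 : ℝ) < Fintype.card F := by exact_mod_cast Fintype.one_lt_card (α := F)
  have hne : (Fintype.card F : ℝ) - 1 ≠ 0 := by linarith
  have hw : ∀ a : F, sparseWeight F γ a = γ / ((Fintype.card F : ℝ) - 1)
      + if a = 0 then 1 - γ - γ / ((Fintype.card F : ℝ) - 1) else 0 := by
    intro a
    unfold sparseWeight
    split_ifs <;> ring
  simp only [hw, Finset.sum_add_distrib, Finset.sum_ite_eq', Finset.sum_const, Finset.card_univ,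
    Finset.mem_univ, if_true, nsmul_eq_mul]
  field_simp
  ring

theorem sparseWeight_sub_inv_card (γ : ℝ) (a : F) :
    sparseWeight F γ a - (Fintype.card F : ℝ)⁻¹
      = (1 - γ / (1 - (Fintype.card F : ℝ)⁻¹))
        * ((if a = 0 then 1 else 0) - (Fintype.card F : ℝ)⁻¹) := by
  have hcard : (1 : ℝ) < Fintype.card F := by exact_mod_cast Fintype.one_lt_card (α := F)
  have hne : (Fintype.card F : ℝ) - 1 ≠ 0 := by linarith
  have hne0 : (Fintype.card F : ℝ) ≠ 0 := by linarith
  have hinv : 1 - (Fintype.card F : ℝ)⁻¹ = ((Fintype.card F : ℝ) - 1) / Fintype.card F := by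
    field_simp
  unfold sparseWeight
  rw [hinv]
  split_ifs
  · field_simp
    ring
  · field_simp
    ring

theorem sum_sparseWeight_mul_eq_sub_inv_card (γ : ℝ) (m q : F) :
    (∑ b : F, if b * m = q then sparseWeight F γ b else 0) - (Fintype.card F : ℝ)⁻¹
      = (if m ≠ 0 then 1 - γ / (1 - (Fintype.card F : ℝ)⁻¹) else 1)
        * ((if q = 0 then 1 else 0) - (Fintype.card F : ℝ)⁻¹) := by
  by_cases hm : m = 0
  · subst hm
    by_cases hq : q = 0
    · simp [hq, sum_sparseWeight]
    · simp [hq, Ne.symm hq]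
  · have hdiv : ∀ b : F, b * m = q ↔ b = q / m := fun b => (eq_div_iff hm).symm
    simp only [hdiv, Finset.sum_ite_eq', Finset.mem_univ, if_true, sparseWeight_sub_inv_card]
    simp [hm]

theorem sum_prod_sparseWeight (γ : ℝ) {N : ℕ} (μ : Fin N → F) (q : F) :
    (∑ a : Fin N → F, if ∑ i, a i * μ i = q then ∏ i, sparseWeight F γ (a i) else 0)
      = (Fintype.card F : ℝ)⁻¹
        + (∏ i, if μ i ≠ 0 then 1 - γ / (1 - (Fintype.card F : ℝ)⁻¹) else 1)
          * ((if q = 0 then 1 else 0) - (Fintype.card F : ℝ)⁻¹) := by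
  induction N generalizing q with
  | zero => simp [eq_comm]
  | succ n ih =>
    rw [← (Fin.consEquiv fun _ : Fin (n + 1) => F).sum_comp, Fintype.sum_prod_type,
      Fin.prod_univ_succ, mul_right_comm, ← sum_sparseWeight_mul_eq_sub_inv_card]
    have hstep : ∀ b : F, (∑ a : Fin n → F,
        if ∑ i, (Fin.cons b a : Fin (n + 1) → F) i * μ i = q then
          ∏ i, sparseWeight F γ ((Fin.cons b a : Fin (n + 1) → F) i) else 0)
        = sparseWeight F γ b * ((Fintype.card F : ℝ)⁻¹
          + (∏ i : Fin n, if μ i.succ ≠ 0 then 1 - γ / (1 - (Fintype.card F : ℝ)⁻¹) else 1)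
            * ((if b * μ 0 = q then 1 else 0) - (Fintype.card F : ℝ)⁻¹)) := by
      intro b
      have h := ih (fun i => μ i.succ) (q - b * μ 0)
      have hiff : q - b * μ 0 = 0 ↔ b * μ 0 = q := by rw [sub_eq_zero, eq_comm]
      simp only [hiff] at h
      rw [← h, Finset.mul_sum]
      refine Finset.sum_congr rfl fun a _ => ?_
      simp only [Fin.sum_univ_succ, Fin.prod_univ_succ, Fin.cons_zero, Fin.cons_succ, mul_ite,
        mul_zero, eq_sub_iff_add_eq']
    refine (Finset.sum_congr rfl fun b _ => hstep b).trans ?_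
    generalize (∏ i : Fin n, if μ i.succ ≠ 0 then 1 - γ / (1 - (Fintype.card F : ℝ)⁻¹) else 1) = L
    have hterm : ∀ b : F, sparseWeight F γ b * ((Fintype.card F : ℝ)⁻¹
          + L * ((if b * μ 0 = q then 1 else 0) - (Fintype.card F : ℝ)⁻¹))
        = sparseWeight F γ b * ((Fintype.card F : ℝ)⁻¹ - L * (Fintype.card F : ℝ)⁻¹)
          + L * (if b * μ 0 = q then sparseWeight F γ b else 0) := by
      intro b
      split_ifs <;> ring
    simp only [hterm, Finset.sum_add_distrib, ← Finset.sum_mul, ← Finset.mul_sum,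
      sum_sparseWeight]
    ring

end SparseWeight

/-- Single-row version of the paper's Lemma 2 (following [rankmin, Lemma 21]):
for independent `𝔽_Q`-valued random variables `A_1, …, A_N`, each `0` with probability
`1 − γ` and each nonzero element with probability `γ/(Q−1)`, and a fixed vector `μ`
of Hamming weight `d₁ ≥ 1`, the probability that `∑ i, A i * μ i = 0` is
`Q⁻¹ + (1 − γ/(1−Q⁻¹))^{d₁} (1 − Q⁻¹)`, and for every nonzero `q` the probability of
`∑ i, A i * μ i = q` is `Q⁻¹ − (1 − γ/(1−Q⁻¹))^{d₁} Q⁻¹`. -/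
theorem stmt1 {F : Type*} [Field F] [Fintype F] [DecidableEq F]
    {Q : ℕ} (hQcard : Fintype.card F = Q) (hQ : 2 ≤ Q)
    {γ : ℝ} (hγ0 : 0 < γ) (hγ1 : γ ≤ 1 - 1 / (Q : ℝ))
    {Ω : Type*} [MeasurableSpace Ω] (P : Measure Ω) [IsProbabilityMeasure P]
    {N : ℕ} (A : Fin N → Ω → F)
    (hindep : ∀ a : Fin N → F,
      P {ω | ∀ i, A i ω = a i} = ∏ i, P {ω | A i ω = a i})
    (hdist0 : ∀ i, P {ω | A i ω = 0} = ENNReal.ofReal (1 - γ))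
    (hdistq : ∀ i, ∀ q : F, q ≠ 0 →
      P {ω | A i ω = q} = ENNReal.ofReal (γ / ((Q : ℝ) - 1)))
    (μ : Fin N → F) {d₁ : ℕ} (hd₁ : 1 ≤ d₁)
    (hweight : (Finset.univ.filter (fun i => μ i ≠ 0)).card = d₁) :
    (P {ω | ∑ i, A i ω * μ i = 0}).toReal
        = (Q : ℝ)⁻¹ + (1 - γ / (1 - (Q : ℝ)⁻¹)) ^ d₁ * (1 - (Q : ℝ)⁻¹)
    ∧ ∀ q : F, q ≠ 0 →
      (P {ω | ∑ i, A i ω * μ i = q}).toReal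
        = (Q : ℝ)⁻¹ - (1 - γ / (1 - (Q : ℝ)⁻¹)) ^ d₁ * (Q : ℝ)⁻¹ := by
  subst hQcard
  have hcard : (1 : ℝ) < Fintype.card F := by exact_mod_cast hQ
  have hγ : γ ≤ 1 := hγ1.trans (by
    have : (0 : ℝ) ≤ 1 / (Fintype.card F : ℝ) := by positivity
    linarith)
  have hnonneg : ∀ a : F, 0 ≤ sparseWeight F γ a := by
    intro a
    unfold sparseWeight
    split_ifs
    · linarith
    · exact div_nonneg hγ0.le (by linarith)
  have hmarg : ∀ i (a : F), P {ω | A i ω = a} = ENNReal.ofReal (sparseWeight F γ a) := by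
    intro i a
    unfold sparseWeight
    split_ifs with h
    · rw [h, hdist0]
    · exact hdistq i a h
  have hjoint : ∀ a : Fin N → F, P {ω | (fun i => A i ω) = a}
      = ENNReal.ofReal (∏ i, sparseWeight F γ (a i)) := by
    intro a
    simp only [funext_iff, hindep, hmarg]
    rw [ENNReal.ofReal_prod_of_nonneg fun i _ => hnonneg _]
  have hsum : ∑ a : Fin N → F, P {ω | (fun i => A i ω) = a} = 1 := by
    simp only [hjoint]
    rw [← ENNReal.ofReal_sum_of_nonneg fun a _ => Finset.prod_nonneg fun i _ => hnonneg _,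
      ← Fintype.prod_sum]
    simp [sum_sparseWeight]
  have key : ∀ q : F, (P {ω | ∑ i, A i ω * μ i = q}).toReal
      = (Fintype.card F : ℝ)⁻¹ + (1 - γ / (1 - (Fintype.card F : ℝ)⁻¹)) ^ d₁
        * ((if q = 0 then 1 else 0) - (Fintype.card F : ℝ)⁻¹) := by
    intro q
    have hpow : (∏ i, if μ i ≠ 0 then 1 - γ / (1 - (Fintype.card F : ℝ)⁻¹) else 1)
        = (1 - γ / (1 - (Fintype.card F : ℝ)⁻¹)) ^ d₁ := by
      rw [← Finset.prod_filter, Finset.prod_const, hweight]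
    rw [← hpow, ← sum_prod_sparseWeight,
      measure_setOf_comp_eq_sum P (fun ω i => A i ω) hsum (fun a => ∑ i, a i * μ i = q),
      ENNReal.toReal_sum]
    · refine Finset.sum_congr rfl fun a _ => ?_
      rw [hjoint]
      split_ifs
      · exact ENNReal.toReal_ofReal (Finset.prod_nonneg fun i _ => hnonneg _)
      · rfl
    · intro a _
      split_ifs
      · exact measure_ne_top _ _
      · exact ENNReal.zero_ne_top
  refine ⟨by simp [key], fun q hq => ?_⟩
  rw [key, if_neg hq]
  ring
end

section
/- Let 𝔽_Q be a finite field with Q ≥ 2 elements and let 0 < γ ≤ 1 − 1/Q. Let A be a random M × N matrix over 𝔽_Q whose MN entries are independent, each taking the value 0 with probability 1 − γ and each nonzero element of 𝔽_Q with probability γ/(Q−1). Let μ ∈ 𝔽_Q^N be a fixed vector with exactly d₁ ≥ 1 nonzero coordinates, and let s ∈ 𝔽_Q^M be a fixed vector with exactly d₂ nonzero coordinates (0 ≤ d₂ ≤ M). Then Pr(Aμ = s) = (Q^{-1} + (1 − γ/(1−Q^{-1}))^{d₁}(1 − Q^{-1}))^{M−d₂} · (Q^{-1} − (1 − γ/(1−Q^{-1}))^{d₁}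 Q^{-1})^{d₂}. -/
open MeasureTheory Matrix

/-- If finitely many sets covering a probability space have outer measures summing to one, then
the outer measure is additive on unions of them, even without measurability. -/
theorem measure_setOf_eq_sum_of_sum_eq_one {Ω α : Type*} [MeasurableSpace Ω] (P : Measure Ω)
    [IsProbabilityMeasure P] [Fintype α] (X : Ω → α)
    (hX : ∑ a, P {ω | X ω = a} = 1) (p : α → Prop) [DecidablePred p] :
    P {ω | p (X ω)} = ∑ a with p a, P {ω | X ω = a} := by
  have upper (q : α → Prop) [DecidablePred q] :
      P {ω | q (X ω)} ≤ ∑ a with q a, P {ω | X ω = a} := by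
    refine (measure_mono fun ω hω => ?_).trans
      (measure_biUnion_finset_le (Finset.univ.filter q) fun a => {ω | X ω = a})
    simpa using hω
  refine le_antisymm (upper p) ?_
  have hne : ∑ a with ¬ p a, P {ω | X ω = a} ≠ ⊤ :=
    ENNReal.sum_ne_top.2 fun a _ => measure_ne_top P _
  refine (ENNReal.add_le_add_iff_right hne).1 ?_
  rw [Finset.sum_filter_add_sum_filter_not, hX, ← measure_univ (μ := P)]
  calc P Set.univ ≤ P ({ω | p (X ω)} ∪ {ω | ¬ p (X ω)}) :=
        measure_mono fun ω _ => em (p (X ω))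
    _ ≤ P {ω | p (X ω)} + P {ω | ¬ p (X ω)} := measure_union_le _ _
    _ ≤ _ := by gcongr; exact upper fun a => ¬ p a

/-- The mixture of the point mass at `0` (with weight `c`) and the uniform distribution on `F`. -/
noncomputable def mixedMass (F : Type*) [Field F] [Fintype F] [DecidableEq F] (c : ℝ) (q : F) : ℝ :=
  (if q = 0 then c else 0) + (1 - c) * (Fintype.card F : ℝ)⁻¹

section MixedMass

variable {F : Type*} [Field F] [Fintype F] [DecidableEq F]

theorem sum_mixedMass (c : ℝ) : ∑ q, mixedMass F c q = 1 := by
  have h : (Fintype.card F : ℝ) ≠ 0 := by simp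
  simp only [mixedMass, Finset.sum_add_distrib, Finset.sum_ite_eq', Finset.mem_univ, if_true,
    Finset.sum_const, Finset.card_univ, nsmul_eq_mul]
  field_simp
  ring

theorem sum_mixedMass_mul_mixedMass (c c' : ℝ) {m : F} (hm : m ≠ 0) (t : F) :
    ∑ q, mixedMass F c q * mixedMass F c' (t - q * m) = mixedMass F (c * c') t := by
  have hsum : ∑ q : F, mixedMass F c' (t - q * m) = 1 := by
    rw [← sum_mixedMass (F := F) c']
    exact Equiv.sum_comp ((Equiv.mulRight₀ m hm).trans (Equiv.subLeft t)) (mixedMass F c')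
  have hexp (q : F) : mixedMass F c q * mixedMass F c' (t - q * m) =
      (if q = 0 then c * mixedMass F c' (t - q * m) else 0)
        + (1 - c) * (Fintype.card F : ℝ)⁻¹ * mixedMass F c' (t - q * m) := by
    conv_lhs => rw [mixedMass]
    split_ifs <;> ring
  rw [Finset.sum_congr rfl fun q _ => hexp q, Finset.sum_add_distrib, ← Finset.mul_sum, hsum]
  simp only [Finset.sum_ite_eq', Finset.mem_univ, if_true, zero_mul, sub_zero, mixedMass]
  split_ifs <;> ring

theorem sum_prod_mixedMass_dotProduct_eq (c : ℝ) {N : ℕ} (μ : Fin N → F) (t : F) :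
    ∑ r : Fin N → F, (if r ⬝ᵥ μ = t then ∏ j, mixedMass F c (r j) else 0)
      = mixedMass F (∏ j, if μ j = 0 then 1 else c) t := by
  induction N generalizing t with
  | zero => simp [mixedMass, eq_comm]
  | succ n ih =>
    rw [← (Fin.consEquiv fun _ => F).sum_comp, Fintype.sum_prod_type]
    have hinner (q : F) :
        ∑ r : Fin n → F, (if (Fin.cons q r : Fin (n + 1) → F) ⬝ᵥ μ = t then
            ∏ j, mixedMass F c ((Fin.cons q r : Fin (n + 1) → F) j) else 0)
          = mixedMass F c q
            * mixedMass F (∏ j : Fin n, if μ j.succ = 0 then 1 else c) (t - q * μ 0) := by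
      rw [← ih (fun j => μ j.succ), Finset.mul_sum]
      refine Finset.sum_congr rfl fun r _ => ?_
      simp only [dotProduct, Fin.sum_univ_succ, Fin.prod_univ_succ, Fin.cons_zero, Fin.cons_succ,
        mul_ite, mul_zero, eq_sub_iff_add_eq']
    refine (Finset.sum_congr rfl fun q _ => hinner q).trans ?_
    rw [Fin.prod_univ_succ]
    by_cases h0 : μ 0 = 0
    · simp [h0, ← Finset.sum_mul, sum_mixedMass]
    · rw [if_neg h0, sum_mixedMass_mul_mixedMass c _ h0]

theorem sum_prod_mixedMass_mulVec_eq (c : ℝ) {M N : ℕ} (μ : Fin N → F) (s : Fin M → F) :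
    ∑ B : Matrix (Fin M) (Fin N) F with B *ᵥ μ = s, ∏ i, ∏ j, mixedMass F c (B i j)
      = ∏ i, mixedMass F (∏ j, if μ j = 0 then 1 else c) (s i) := by
  simp_rw [← sum_prod_mixedMass_dotProduct_eq]
  rw [Finset.prod_univ_sum, Fintype.piFinset_univ, Finset.sum_filter]
  refine Finset.sum_congr rfl fun B _ => ?_
  rw [Finset.prod_ite_zero]
  simp [funext_iff, mulVec]

theorem sum_prod_mixedMass (c : ℝ) (M N : ℕ) :
    ∑ B : Matrix (Fin M) (Fin N) F, ∏ i, ∏ j, mixedMass F c (B i j) = 1 := by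
  have h := sum_prod_mixedMass_mulVec_eq c (0 : Fin N → F) (0 : Fin M → F)
  simpa [mixedMass] using h

end MixedMass

/-- The paper's Lemma 2, explicit formula: for a random `M × N` matrix `A` over `𝔽_Q`
with iid entries (`0` with probability `1 − γ`, each nonzero element with probability
`γ/(Q−1)`), a fixed vector `μ` of Hamming weight `d₁ ≥ 1` and a fixed vector `s` of
Hamming weight `d₂`, the probability that `Aμ = s` equals
`(Q⁻¹ + (1 − γ/(1−Q⁻¹))^{d₁}(1 − Q⁻¹))^{M−d₂} · (Q⁻¹ − (1 − γ/(1−Q⁻¹))^{d₁} Q⁻¹)^{d₂}`. -/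
theorem stmt2 {F : Type*} [Field F] [Fintype F] [DecidableEq F]
    {Q : ℕ} (hQcard : Fintype.card F = Q) (hQ : 2 ≤ Q)
    {γ : ℝ} (hγ0 : 0 < γ) (hγ1 : γ ≤ 1 - 1 / (Q : ℝ))
    {Ω : Type*} [MeasurableSpace Ω] (P : Measure Ω) [IsProbabilityMeasure P]
    {M N : ℕ} (A : Ω → Matrix (Fin M) (Fin N) F)
    (hindep : ∀ A₀ : Matrix (Fin M) (Fin N) F,
      P {ω | A ω = A₀} = ∏ i, ∏ j, P {ω | A ω i j = A₀ i j})
    (hdist0 : ∀ i j, P {ω | A ω i j = 0} = ENNReal.ofReal (1 - γ))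
    (hdistq : ∀ i j, ∀ q : F, q ≠ 0 →
      P {ω | A ω i j = q} = ENNReal.ofReal (γ / ((Q : ℝ) - 1)))
    (μ : Fin N → F) {d₁ : ℕ} (hd₁ : 1 ≤ d₁)
    (hμ : (Finset.univ.filter (fun j => μ j ≠ 0)).card = d₁)
    (s : Fin M → F) {d₂ : ℕ} (hd₂ : d₂ ≤ M)
    (hs : (Finset.univ.filter (fun i => s i ≠ 0)).card = d₂) :
    (P {ω | (A ω) *ᵥ μ = s}).toReal
      = ((Q : ℝ)⁻¹ + (1 - γ / (1 - (Q : ℝ)⁻¹)) ^ d₁ * (1 - (Q : ℝ)⁻¹)) ^ (M - d₂)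
        * ((Q : ℝ)⁻¹ - (1 - γ / (1 - (Q : ℝ)⁻¹)) ^ d₁ * (Q : ℝ)⁻¹) ^ d₂ := by
  have hQ' : (2 : ℝ) ≤ Q := by exact_mod_cast hQ
  have hQ0 : (Q : ℝ) ≠ 0 := by positivity
  have hQ1 : (Q : ℝ) - 1 ≠ 0 := by linarith
  set c : ℝ := 1 - γ / (1 - (Q : ℝ)⁻¹) with hc
  have hinv : 1 - (Q : ℝ)⁻¹ = (Q - 1) / Q := by field_simp
  have hzero : mixedMass F c 0 = 1 - γ := by
    rw [mixedMass, if_pos rfl, hQcard, hc, hinv]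
    field_simp
    ring
  have hnonzero (q : F) (hq : q ≠ 0) : mixedMass F c q = γ / (Q - 1) := by
    rw [mixedMass, if_neg hq, hQcard, hc, hinv]
    field_simp
    ring
  have hγ : γ ≤ 1 := hγ1.trans (by simp)
  have hnonneg (q : F) : 0 ≤ mixedMass F c q := by
    by_cases hq : q = 0
    · rw [hq, hzero]; linarith
    · rw [hnonzero q hq]; exact div_nonneg hγ0.le (by linarith)
  have hentry (i j) (q : F) : P {ω | A ω i j = q} = ENNReal.ofReal (mixedMass F c q) := by
    by_cases hq : q = 0
    · rw [hq, hzero, hdist0]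
    · rw [hnonzero q hq, hdistq i j q hq]
  have hmatrix (B : Matrix (Fin M) (Fin N) F) :
      P {ω | A ω = B} = ENNReal.ofReal (∏ i, ∏ j, mixedMass F c (B i j)) := by
    refine (hindep B).trans (.trans (Finset.prod_congr rfl fun i _ => ?_)
      (ENNReal.ofReal_prod_of_nonneg fun i _ => Finset.prod_nonneg fun j _ => hnonneg _).symm)
    exact (Finset.prod_congr rfl fun j _ => hentry i j _).trans
      (ENNReal.ofReal_prod_of_nonneg fun j _ => hnonneg _).symm
  have hprod (B : Matrix (Fin M) (Fin N) F) : 0 ≤ ∏ i, ∏ j, mixedMass F c (B i j) :=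
    Finset.prod_nonneg fun i _ => Finset.prod_nonneg fun j _ => hnonneg _
  have htotal : ∑ B, P {ω | A ω = B} = 1 := by
    simp_rw [hmatrix]
    rw [← ENNReal.ofReal_sum_of_nonneg fun B _ => hprod B, sum_prod_mixedMass, ENNReal.ofReal_one]
  rw [measure_setOf_eq_sum_of_sum_eq_one P A htotal fun B => B *ᵥ μ = s]
  simp_rw [hmatrix]
  rw [← ENNReal.ofReal_sum_of_nonneg fun B _ => hprod B,
    ENNReal.toReal_ofReal (Finset.sum_nonneg fun B _ => hprod B), sum_prod_mixedMass_mulVec_eq]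
  have hpow : (∏ j, if μ j = 0 then 1 else c) = c ^ d₁ := by
    rw [Finset.prod_ite, Finset.prod_const_one, one_mul, Finset.prod_const, hμ]
  have hcard : (Finset.univ.filter fun i => s i = 0).card = M - d₂ := by
    have h := Finset.card_filter_add_card_filter_not (s := Finset.univ) fun i => s i = 0
    rw [Finset.card_univ, Fintype.card_fin, hs] at h
    omega
  have hval (i) : mixedMass F (c ^ d₁) (s i) =
      if s i = 0 then (Q : ℝ)⁻¹ + c ^ d₁ * (1 - (Q : ℝ)⁻¹)
      else (Q : ℝ)⁻¹ - c ^ d₁ * (Q : ℝ)⁻¹ := by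
    rw [mixedMass, hQcard]
    split_ifs <;> ring
  simp_rw [hpow, hval]
  rw [Finset.prod_ite, Finset.prod_const, Finset.prod_const, hcard, hs]
end

section
/- Let Φ and Z be finite sets, let p be a probability mass function on Φ, and for each φ ∈ Φ let w_φ be a probability mass function on Z (the conditional distribution given φ). Let ε ≥ 0, let T ⊆ Φ, and for each θ ∈ T let B(θ) ⊆ Z be a subset such that: (i) B(θ) ∩ B(φ) = ∅ whenever θ, φ ∈ T and θ ≠ φ; (ii) ∑_{z ∈ B(φ)} w_φ(z) ≥ 1 − ε for every φ ∈ T; (iii) ∑_{φ ∉ T} p(φ) ≤ ε. Then ∑_{θ ∈ T} ∑_{φ ∈ Φ, φ ≠ θ} ∑_{z ∈ B(θ)} p(φ) w_φ(z) ≤ 2ε. -/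
/-- The masses that a nonnegative function gives to pairwise disjoint sets add up to at most
its total mass. -/
theorem sum_sum_le_sum_univ_of_pairwiseDisjoint {ι Z : Type*} [Fintype Z]
    (T : Finset ι) (B : ι → Finset Z) (f : Z → ℝ) (hf : ∀ z, 0 ≤ f z)
    (hdisj : (T : Set ι).PairwiseDisjoint B) :
    ∑ θ ∈ T, ∑ z ∈ B θ, f z ≤ ∑ z, f z := by
  classical
  rw [← Finset.sum_biUnion hdisj]
  exact Finset.sum_le_sum_of_subset_of_nonneg (Finset.subset_univ _) fun z _ _ => hf z

/-- Abstract finite form of the paper's Lemma 4: `p` is a pmf on a finite set `Φ`,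
`w φ` is a conditional pmf on a finite set `Z` for each `φ`, `T ⊆ Φ` with
pairwise-disjoint sets `B θ ⊆ Z` for `θ ∈ T`, each `B φ` carrying conditional mass
at least `1 − ε`, and the complement of `T` carrying mass at most `ε`.  Then
`∑_{θ∈T} ∑_{φ≠θ} ∑_{z∈B(θ)} p(φ)·w_φ(z) ≤ 2ε`. -/
theorem stmt7 {Φ Z : Type*} [Fintype Φ] [DecidableEq Φ] [Fintype Z]
    (p : Φ → ℝ) (hp0 : ∀ φ, 0 ≤ p φ) (hp1 : ∑ φ, p φ = 1)
    (w : Φ → Z → ℝ) (hw0 : ∀ φ z, 0 ≤ w φ z) (hw1 : ∀ φ, ∑ z, w φ z = 1)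
    (ε : ℝ) (hε : 0 ≤ ε)
    (T : Finset Φ) (B : Φ → Finset Z)
    (hdisj : ∀ θ ∈ T, ∀ φ ∈ T, θ ≠ φ → Disjoint (B θ) (B φ))
    (hmass : ∀ φ ∈ T, 1 - ε ≤ ∑ z ∈ B φ, w φ z)
    (hTc : ∑ φ ∈ Tᶜ, p φ ≤ ε) :
    ∑ θ ∈ T, ∑ φ ∈ Finset.univ.filter (fun φ => φ ≠ θ), ∑ z ∈ B θ, p φ * w φ z
      ≤ 2 * ε := by
  have hdisj' : (T : Set Φ).PairwiseDisjoint B := fun θ hθ φ hφ h => hdisj θ hθ φ hφ h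
  have htotal (φ : Φ) : ∑ θ ∈ T, ∑ z ∈ B θ, w φ z ≤ 1 :=
    hw1 φ ▸ sum_sum_le_sum_univ_of_pairwiseDisjoint T B (w φ) (hw0 φ) hdisj'
  have hswap : ∑ θ ∈ T, ∑ φ ∈ Finset.univ.filter (fun φ => φ ≠ θ), ∑ z ∈ B θ, p φ * w φ z
      = ∑ φ, p φ * ∑ θ ∈ T.erase φ, ∑ z ∈ B θ, w φ z := by
    simp only [Finset.mul_sum]
    refine Finset.sum_comm' fun θ φ => ?_
    simp [and_comm, eq_comm]
  have hmem : ∀ φ ∈ T, p φ * ∑ θ ∈ T.erase φ, ∑ z ∈ B θ, w φ z ≤ p φ * ε := fun φ hφ => by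
    refine mul_le_mul_of_nonneg_left ?_ (hp0 φ)
    have hsplit := Finset.add_sum_erase T (fun θ => ∑ z ∈ B θ, w φ z) hφ
    linarith [htotal φ, hmass φ hφ]
  have hcompl : ∀ φ ∈ Tᶜ, p φ * ∑ θ ∈ T.erase φ, ∑ z ∈ B θ, w φ z ≤ p φ := fun φ hφ => by
    rw [Finset.erase_eq_of_notMem (Finset.mem_compl.mp hφ)]
    exact mul_le_of_le_one_right (hp0 φ) (htotal φ)
  have hpT : ∑ φ ∈ T, p φ ≤ 1 :=
    hp1 ▸ Finset.sum_le_sum_of_subset_of_nonneg (Finset.subset_univ T) fun φ _ _ => hp0 φ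
  rw [hswap, ← Finset.sum_add_sum_compl T]
  calc _ ≤ ∑ φ ∈ T, p φ * ε + ∑ φ ∈ Tᶜ, p φ :=
        add_le_add (Finset.sum_le_sum hmem) (Finset.sum_le_sum hcompl)
    _ = (∑ φ ∈ T, p φ) * ε + ∑ φ ∈ Tᶜ, p φ := by rw [Finset.sum_mul]
    _ ≤ 1 * ε + ε := add_le_add (mul_le_mul_of_nonneg_right hpT hε) hTc
    _ = 2 * ε := by ring
end

section
/- Let 𝔽_Q be a finite field with Q ≥ 2 elements, let N, M ≥ 1, let 0 < γ ≤ 1 − 1/Q, let 0 < α < 1/2 and ε ≥ 0. Let Θ be a random vector in 𝔽_Q^N with pmf p, let U be a random vector in 𝔽_Q^M with pmf q, and let A be a random M × N matrix over 𝔽_Q whose entries are iid, equal to 0 with probability 1 − γ and to each nonzero element of 𝔽_Q with probability γ/(Q−1); assume Θ, U, A are mutually independent. Suppose T_Θ ⊆ 𝔽_Q^N and T_U ⊆ 𝔽_Q^M satisfy Pr(Θ ∈ T_Θ) ≥ 1 − ε and Pr(U ∈ T_U) ≥ 1 − ε. Then the probability that there exists φ ∈ 𝔽_Q^N with φ ≠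 Θ and p(φ)·q(AΘ + U − Aφ) ≥ p(Θ)·q(U) is at most |T_U|·(1−γ)^M·αN·2^{N·H₂(α)}·(Q−1)^{αN} + |T_Θ|·|T_U|·(Q^{-1} + (1 − γ/(1−Q^{-1}))^{⌈αN⌉}·(1 − Q^{-1}))^M + 2ε. -/
open MeasureTheory Matrix

/-- The binary entropy function `H₂` (base 2), with the convention `0 · log₂ 0 = 0`
(automatic since `Real.logb 2 0 = 0`). -/
noncomputable def binEnt (t : ℝ) : ℝ :=
  -(t * Real.logb 2 t) - (1 - t) * Real.logb 2 (1 - t)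

/-- Probability mass at `c` of a random element of `F` that is `0` with probability `1 - γ` and
uniform over the nonzero elements otherwise. -/
noncomputable def sparseMass (F : Type*) [Field F] [Fintype F] [DecidableEq F] (γ : ℝ) (c : F) : ℝ :=
  if c = 0 then 1 - γ else γ / ((Fintype.card F : ℝ) - 1)

/-- Probability that a row of iid `sparseMass F γ` entries is orthogonal to a fixed vector of
Hamming weight `d`. -/
noncomputable def collisionProb (F : Type*) [Fintype F] (γ : ℝ) (d : ℕ) : ℝ :=
  (Fintype.card F : ℝ)⁻¹ +
    (1 - γ / (1 - (Fintype.card F : ℝ)⁻¹)) ^ d * (1 - (Fintype.card F : ℝ)⁻¹)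

section CollisionProb

variable {F : Type*} [Fintype F] [Nontrivial F]

theorem two_le_card_real : (2 : ℝ) ≤ Fintype.card F := by
  exact_mod_cast Fintype.one_lt_card (α := F)

theorem collisionProb_le_of_le {γ : ℝ} (h0 : 0 ≤ γ)
    (h1 : γ ≤ 1 - (Fintype.card F : ℝ)⁻¹) {c d : ℕ} (hcd : c ≤ d) :
    collisionProb F γ d ≤ collisionProb F γ c := by
  have h2 : (1 : ℝ) < Fintype.card F := one_lt_two.trans_le two_le_card_real
  have h3 : 0 < 1 - (Fintype.card F : ℝ)⁻¹ := sub_pos.2 (inv_lt_one_of_one_lt₀ h2)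
  have h4 : γ / (1 - (Fintype.card F : ℝ)⁻¹) ≤ 1 := (div_le_one h3).2 h1
  have h5 : 0 ≤ γ / (1 - (Fintype.card F : ℝ)⁻¹) := div_nonneg h0 h3.le
  unfold collisionProb
  gcongr _ + ?_ * _
  exact pow_le_pow_of_le_one (by linarith) (by linarith) hcd

theorem collisionProb_one (γ : ℝ) : collisionProb F γ 1 = 1 - γ := by
  have h2 : (1 : ℝ) < Fintype.card F := one_lt_two.trans_le two_le_card_real
  have h3 : 1 - (Fintype.card F : ℝ)⁻¹ ≠ 0 := (sub_pos.2 (inv_lt_one_of_one_lt₀ h2)).ne'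
  unfold collisionProb
  rw [pow_one, sub_mul, div_mul_cancel₀ _ h3]
  ring

theorem collisionProb_nonneg {γ : ℝ}
    (h1 : γ ≤ 1 - (Fintype.card F : ℝ)⁻¹) (d : ℕ) : 0 ≤ collisionProb F γ d := by
  have h2 : (1 : ℝ) < Fintype.card F := one_lt_two.trans_le two_le_card_real
  have h3 : 0 < 1 - (Fintype.card F : ℝ)⁻¹ := sub_pos.2 (inv_lt_one_of_one_lt₀ h2)
  have h4 : 0 ≤ 1 - γ / (1 - (Fintype.card F : ℝ)⁻¹) := sub_nonneg.2 ((div_le_one h3).2 h1)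
  unfold collisionProb
  positivity

end CollisionProb

section SparseMatrix

variable {F : Type*} [Field F] [Fintype F] [DecidableEq F]

theorem sparseMass_eq (γ : ℝ) (c : F) :
    sparseMass F γ c = (Fintype.card F : ℝ)⁻¹ + (1 - γ / (1 - (Fintype.card F : ℝ)⁻¹)) *
      ((if c = 0 then 1 else 0) - (Fintype.card F : ℝ)⁻¹) := by
  have h2 := two_le_card_real (F := F)
  have h0 : (Fintype.card F : ℝ) ≠ 0 := by positivity
  have h1 : (Fintype.card F : ℝ) - 1 ≠ 0 := by linarith
  unfold sparseMass
  have h3 : (1 - (Fintype.card F : ℝ)⁻¹) = ((Fintype.card F : ℝ) - 1) / Fintype.card F := by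
    field_simp
  rw [h3]
  split_ifs <;> field_simp <;> ring

theorem sum_sparseMass (γ : ℝ) : ∑ c : F, sparseMass F γ c = 1 := by
  have h2 := two_le_card_real (F := F)
  have h0 : (Fintype.card F : ℝ) ≠ 0 := by positivity
  simp [sparseMass_eq, Finset.sum_add_distrib, ← Finset.mul_sum, Finset.sum_sub_distrib, h0]

theorem sparseMass_nonneg {γ : ℝ} (h0 : 0 ≤ γ) (h1 : γ ≤ 1) (c : F) : 0 ≤ sparseMass F γ c := by
  have h2 := two_le_card_real (F := F)
  unfold sparseMass
  split_ifs
  · linarith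
  · exact div_nonneg h0 (by linarith)

theorem sum_prod_sparseMass (γ : ℝ) {ι : Type*} [Fintype ι] [DecidableEq ι] :
    ∑ r : ι → F, ∏ j, sparseMass F γ (r j) = 1 := by
  rw [← Fintype.piFinset_univ, ← Finset.prod_univ_sum]
  simp [sum_sparseMass]

theorem sum_prod_prod_sparseMass (γ : ℝ) (M N : ℕ) :
    ∑ A : Matrix (Fin M) (Fin N) F, ∏ i, ∏ j, sparseMass F γ (A i j) = 1 := by
  change ∑ A : Fin M → Fin N → F, ∏ i, ∏ j, sparseMass F γ (A i j) = 1
  rw [← Fintype.piFinset_univ,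
    ← Finset.prod_univ_sum (fun _ => Finset.univ) fun (_ : Fin M) (r : Fin N → F) =>
      ∏ j, sparseMass F γ (r j)]
  simp [sum_prod_sparseMass]

theorem sum_prod_sparseMass_dotProduct_eq (γ : ℝ) :
    ∀ {n : ℕ} (x : Fin n → F) (s : F),
      ∑ r : Fin n → F, (∏ j, sparseMass F γ (r j)) * (if r ⬝ᵥ x = s then 1 else 0) =
        (Fintype.card F : ℝ)⁻¹ + (1 - γ / (1 - (Fintype.card F : ℝ)⁻¹)) ^ hammingNorm x *
          ((if s = 0 then 1 else 0) - (Fintype.card F : ℝ)⁻¹) := by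
  intro n
  induction n with
  | zero =>
    intro x s
    simp [hammingNorm, dotProduct, eq_comm]
  | succ n ih =>
    intro x s
    rw [← (Fin.consEquiv fun _ => F).sum_comp, Fintype.sum_prod_type]
    have key : ∀ c : F, ∑ r : Fin n → F,
        (∏ j, sparseMass F γ ((Fin.consEquiv fun _ => F) (c, r) j)) *
          (if ((Fin.consEquiv fun _ => F) (c, r) : Fin (n + 1) → F) ⬝ᵥ x = s then (1 : ℝ) else 0) =
        sparseMass F γ c * ((Fintype.card F : ℝ)⁻¹ +
          (1 - γ / (1 - (Fintype.card F : ℝ)⁻¹)) ^ hammingNorm (Fin.tail x) *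
          ((if s - c * x 0 = 0 then 1 else 0) - (Fintype.card F : ℝ)⁻¹)) := by
      intro c
      rw [← ih, Finset.mul_sum]
      refine Finset.sum_congr rfl fun r _ => ?_
      have : (((Fin.consEquiv fun _ => F) (c, r) : Fin (n + 1) → F) ⬝ᵥ x = s) ↔
          r ⬝ᵥ Fin.tail x = s - c * x 0 := by
        simp [dotProduct, Fin.sum_univ_succ, Fin.tail, Fin.consEquiv, eq_sub_iff_add_eq, add_comm]
      simp only [this]
      rw [Fin.prod_univ_succ]
      simp [Fin.consEquiv]
    rw [Finset.sum_congr rfl fun c _ => key c]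
    have hnorm : hammingNorm x = (if x 0 = 0 then 0 else 1) + hammingNorm (Fin.tail x) := by
      simp only [hammingNorm, Finset.card_filter, Fin.sum_univ_succ, ne_eq, ite_not]
      rfl
    by_cases hx : x 0 = 0
    · simp only [hx, mul_zero, sub_zero, ← Finset.sum_mul, sum_sparseMass, hnorm, if_true, zero_add,
        one_mul]
    · have hs : ∀ c : F, s - c * x 0 = 0 ↔ c = s / x 0 := by
        intro c
        rw [sub_eq_zero, eq_div_iff hx, eq_comm]
      have hs0 : s / x 0 = 0 ↔ s = 0 := by simp [hx]
      simp only [hs, mul_add, mul_sub, Finset.sum_add_distrib, Finset.sum_sub_distrib,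
        ← Finset.sum_mul, sum_sparseMass, hnorm, hx, if_false]
      simp only [mul_ite, mul_one, mul_zero, Finset.sum_ite_eq', Finset.mem_univ, if_true,
        sparseMass_eq, hs0]
      split_ifs <;> ring

theorem sum_prod_sparseMass_dotProduct_le {γ : ℝ}
    (h1 : γ ≤ 1 - (Fintype.card F : ℝ)⁻¹) {n : ℕ} (x : Fin n → F) (s : F) :
    ∑ r : Fin n → F, (∏ j, sparseMass F γ (r j)) * (if r ⬝ᵥ x = s then 1 else 0) ≤
      collisionProb F γ (hammingNorm x) := by
  have h2 := two_le_card_real (F := F)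
  have h3 : 0 < 1 - (Fintype.card F : ℝ)⁻¹ := sub_pos.2 (inv_lt_one_of_one_lt₀ (by linarith))
  have h4 : 0 ≤ 1 - γ / (1 - (Fintype.card F : ℝ)⁻¹) := sub_nonneg.2 ((div_le_one h3).2 h1)
  rw [sum_prod_sparseMass_dotProduct_eq, collisionProb]
  gcongr
  split_ifs <;> norm_num

theorem sum_sparseMass_mulVec_le {γ : ℝ} (h0 : 0 ≤ γ)
    (h1 : γ ≤ 1 - (Fintype.card F : ℝ)⁻¹) {M N : ℕ} (x : Fin N → F) (s : Fin M → F) :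
    ∑ A : Matrix (Fin M) (Fin N) F, (∏ i, ∏ j, sparseMass F γ (A i j)) *
      (if A *ᵥ x = s then 1 else 0) ≤ collisionProb F γ (hammingNorm x) ^ M := by
  have hγ : γ ≤ 1 := h1.trans (sub_le_self _ (by positivity))
  have hind : ∀ A : Fin M → Fin N → F, (∏ i, ∏ j, sparseMass F γ (A i j)) *
      (if Matrix.of A *ᵥ x = s then (1 : ℝ) else 0) =
      ∏ i, ((∏ j, sparseMass F γ (A i j)) * (if A i ⬝ᵥ x = s i then 1 else 0)) := by
    intro A
    rw [Finset.prod_mul_distrib, Finset.prod_ite_zero]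
    simp [funext_iff, mulVec]
  change ∑ A : Fin M → Fin N → F, (∏ i, ∏ j, sparseMass F γ (A i j)) *
      (if Matrix.of A *ᵥ x = s then (1 : ℝ) else 0) ≤ _
  rw [Finset.sum_congr rfl fun A _ => hind A, ← Fintype.piFinset_univ,
    ← Finset.prod_univ_sum (fun _ => Finset.univ) fun i r =>
      (∏ j, sparseMass F γ (r j)) * (if r ⬝ᵥ x = s i then (1 : ℝ) else 0)]
  refine (Finset.prod_le_prod (fun i _ => Finset.sum_nonneg fun r _ => ?_)
    fun i _ => sum_prod_sparseMass_dotProduct_le h1 x (s i)).trans (by simp)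
  exact mul_nonneg (Finset.prod_nonneg fun j _ => sparseMass_nonneg h0 hγ _)
    (by split_ifs <;> norm_num)

/-- Averaging a pmf at a random shift `A x + u`. -/
theorem sum_sparseMass_mul_pmf_le {γ : ℝ} (h0 : 0 ≤ γ)
    (h1 : γ ≤ 1 - (Fintype.card F : ℝ)⁻¹) {M N : ℕ} {q : (Fin M → F) → ℝ}
    (hq0 : ∀ u, 0 ≤ q u) (hq1 : ∑ u, q u = 1) (x : Fin N → F) (u : Fin M → F) :
    ∑ A : Matrix (Fin M) (Fin N) F, (∏ i, ∏ j, sparseMass F γ (A i j)) * q (A *ᵥ x + u) ≤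
      collisionProb F γ (hammingNorm x) ^ M := by
  calc
    _ = ∑ v, q v * ∑ A : Matrix (Fin M) (Fin N) F, (∏ i, ∏ j, sparseMass F γ (A i j)) *
          (if A *ᵥ x = v - u then 1 else 0) := by
      simp_rw [Finset.mul_sum]
      rw [Finset.sum_comm]
      refine Finset.sum_congr rfl fun A _ => ?_
      simp only [eq_sub_iff_add_eq, mul_ite, mul_one, mul_zero, Finset.sum_ite_eq, Finset.mem_univ,
        if_true]
      ring
    _ ≤ ∑ v, q v * collisionProb F γ (hammingNorm x) ^ M := by
      gcongr with v
      · exact hq0 v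
      · exact sum_sparseMass_mulVec_le h0 h1 x _
    _ = _ := by rw [← Finset.sum_mul, hq1, one_mul]

theorem rpow_binEnt {α : ℝ} (h0 : 0 < α) (h1 : α < 1) (N : ℝ) :
    (2 : ℝ) ^ (N * binEnt α) = (α ^ (α * N) * (1 - α) ^ (N - α * N))⁻¹ := by
  have h2 : 0 < 1 - α := by linarith
  have e : ∀ {x : ℝ}, 0 < x → ∀ y : ℝ, x ^ y = 2 ^ (Real.logb 2 x * y) := by
    intro x hx y
    rw [Real.rpow_mul (by norm_num), Real.rpow_logb (by norm_num) (by norm_num) hx]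
  rw [e h0, e h2, ← Real.rpow_add (by norm_num), ← Real.rpow_neg (by norm_num)]
  congr 1
  unfold binEnt
  ring

/-- A product of `sparseMass` values depends only on the Hamming weight. -/
theorem prod_sparseMass_eq (α : ℝ) {N : ℕ} (x : Fin N → F) :
    ∏ j, sparseMass F α (x j) = (1 - α) ^ (N - hammingNorm x) *
      (α / ((Fintype.card F : ℝ) - 1)) ^ hammingNorm x := by
  have h := Finset.card_filter_add_card_filter_not (s := (Finset.univ : Finset (Fin N)))
    (fun j => x j = 0)
  simp only [Finset.card_univ, Fintype.card_fin] at h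
  unfold sparseMass
  rw [Finset.prod_ite]
  simp only [Finset.prod_const, hammingNorm]
  congr 2
  simp only [ne_eq]
  omega

/-- Entropy bound on the size of a Hamming ball. -/
theorem card_hammingNorm_le {α : ℝ} (h0 : 0 < α) (h1 : α < 1 / 2) (N : ℕ) :
    (({x : Fin N → F | (hammingNorm x : ℝ) ≤ α * N} : Finset (Fin N → F)).card : ℝ) ≤
      2 ^ ((N : ℝ) * binEnt α) * ((Fintype.card F : ℝ) - 1) ^ (α * N) := by
  have hQ := two_le_card_real (F := F)
  have hQ1 : 1 ≤ (Fintype.card F : ℝ) - 1 := by linarith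
  have hα : 0 < 1 - α := by linarith
  rw [rpow_binEnt h0 (by linarith)]
  set m : ℝ := α ^ (α * N) * (1 - α) ^ (N - α * N) with hm
  have hm0 : 0 < m := by positivity
  set r : ℝ := ((Fintype.card F : ℝ) - 1) ^ (α * N) with hr
  have hr0 : 0 < r := by positivity
  have hpt : ∀ x : Fin N → F, (hammingNorm x : ℝ) ≤ α * N →
      m * r⁻¹ ≤ ∏ j, sparseMass F α (x j) := by
    intro x hx
    have hxN : hammingNorm x ≤ N := by simpa using hammingNorm_le_card_fintype (x := x)
    rw [prod_sparseMass_eq, div_pow, mul_div_assoc', div_eq_mul_inv]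
    refine mul_le_mul ?_ ?_ (by positivity) (by positivity)
    · have e1 : (1 - α) ^ (N - hammingNorm x) =
          (1 - α) ^ ((N : ℝ) - α * N) * (1 - α) ^ (α * N - hammingNorm x) := by
        rw [← Real.rpow_add hα, ← Real.rpow_natCast]
        congr 1
        push_cast [hxN]
        ring
      have e2 : α ^ (α * N) = α ^ (α * N - hammingNorm x) * α ^ hammingNorm x := by
        rw [← Real.rpow_natCast, ← Real.rpow_add h0]
        congr 1
        ring
      rw [hm, e1, e2]
      have : α ^ (α * N - hammingNorm x) ≤ (1 - α) ^ (α * N - hammingNorm x) :=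
        Real.rpow_le_rpow h0.le (by linarith) (by linarith)
      calc
        _ = (1 - α) ^ ((N : ℝ) - α * N) * α ^ (α * N - hammingNorm x) * α ^ hammingNorm x := by
          ring
        _ ≤ _ := by gcongr
    · gcongr
      rw [hr, ← Real.rpow_natCast]
      exact Real.rpow_le_rpow_of_exponent_le hQ1 hx
  have hsum : (({x : Fin N → F | (hammingNorm x : ℝ) ≤ α * N} : Finset (Fin N → F)).card : ℝ) *
      (m * r⁻¹) ≤ 1 := by
    rw [← nsmul_eq_mul, ← sum_prod_sparseMass (F := F) α (ι := Fin N)]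
    refine (Finset.card_nsmul_le_sum _ _ _ fun x hx => hpt x (Finset.mem_filter.1 hx).2).trans ?_
    exact Finset.sum_le_sum_of_subset_of_nonneg (Finset.subset_univ _) fun x _ _ =>
      Finset.prod_nonneg fun j _ => sparseMass_nonneg h0.le (by linarith) _
  have e : m⁻¹ * r = (m * r⁻¹)⁻¹ := by rw [mul_inv m, inv_inv]
  rw [e, ← one_div]
  exact (le_div_iff₀ (by positivity)).2 hsum

theorem card_pos_hammingNorm_lt {α : ℝ} (h0 : 0 < α) (h1 : α < 1 / 2) (N : ℕ) :
    (({x : Fin N → F | x ≠ 0 ∧ (hammingNorm x : ℝ) < α * N} : Finset (Fin N → F)).card : ℝ) ≤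
      α * N * 2 ^ ((N : ℝ) * binEnt α) * ((Fintype.card F : ℝ) - 1) ^ (α * N) := by
  have hQ := two_le_card_real (F := F)
  have hQ1 : 0 ≤ (Fintype.card F : ℝ) - 1 := by linarith
  rcases le_or_gt 1 (α * N) with h | h
  · have hle : (({x : Fin N → F | x ≠ 0 ∧ (hammingNorm x : ℝ) < α * N} :
        Finset (Fin N → F)).card : ℝ) ≤
        (({x : Fin N → F | (hammingNorm x : ℝ) ≤ α * N} : Finset (Fin N → F)).card : ℝ) := by
      refine Nat.cast_le.2 (Finset.card_le_card fun x hx => ?_)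
      simp only [Finset.mem_filter, Finset.mem_univ, true_and] at hx ⊢
      exact hx.2.le
    refine hle.trans ((card_hammingNorm_le h0 h1 N).trans ?_)
    rw [mul_assoc]
    exact le_mul_of_one_le_left (by positivity) h
  · rw [Finset.filter_false_of_mem]
    · simp only [Finset.card_empty, Nat.cast_zero]
      positivity
    · rintro x - ⟨hx, hlt⟩
      have : (1 : ℝ) ≤ hammingNorm x := by exact_mod_cast hammingNorm_pos_iff.2 hx
      linarith

theorem sum_collisionProb_le {γ : ℝ} (h0 : 0 ≤ γ) (h1 : γ ≤ 1 - (Fintype.card F : ℝ)⁻¹)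
    {α : ℝ} (hα0 : 0 < α) (hα1 : α < 1 / 2) (M : ℕ) {N : ℕ} (T : Finset (Fin N → F))
    (φ : Fin N → F) :
    ∑ θ ∈ T with φ ≠ θ, collisionProb F γ (hammingNorm (θ - φ)) ^ M ≤
      (1 - γ) ^ M * (α * N * 2 ^ ((N : ℝ) * binEnt α) * ((Fintype.card F : ℝ) - 1) ^ (α * N)) +
        T.card * collisionProb F γ ⌈α * N⌉₊ ^ M := by
  have hγ : 0 ≤ 1 - γ := sub_nonneg.2 (h1.trans (sub_le_self _ (by positivity)))
  have hpos : ∀ d, 0 ≤ collisionProb F γ d := collisionProb_nonneg h1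
  rw [← Finset.sum_filter_add_sum_filter_not _ fun θ => (hammingNorm (θ - φ) : ℝ) < α * N]
  refine add_le_add ?_ ?_
  · calc
      _ ≤ ∑ θ : Fin N → F with θ - φ ≠ 0 ∧ (hammingNorm (θ - φ) : ℝ) < α * N, (1 - γ) ^ M := by
        refine (Finset.sum_le_sum (g := fun _ => (1 - γ) ^ M) fun θ hθ => ?_).trans
          (Finset.sum_le_sum_of_subset_of_nonneg (fun θ hθ => ?_) fun _ _ _ => by positivity)
        · simp only [Finset.mem_filter] at hθ
          refine pow_le_pow_left₀ (hpos _) ?_ _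
          rw [← collisionProb_one (F := F) γ]
          exact collisionProb_le_of_le h0 h1
            (hammingNorm_pos_iff.2 (sub_ne_zero.2 (Ne.symm hθ.1.2)))
        · simp only [Finset.mem_filter, Finset.mem_univ, true_and] at hθ ⊢
          exact ⟨sub_ne_zero.2 (Ne.symm hθ.1.2), hθ.2⟩
      _ = ∑ x : Fin N → F with x ≠ 0 ∧ (hammingNorm x : ℝ) < α * N, (1 - γ) ^ M := by
        rw [Finset.sum_filter, Finset.sum_filter]
        exact (Equiv.subRight φ).sum_comp fun x =>
          if x ≠ 0 ∧ (hammingNorm x : ℝ) < α * N then (1 - γ) ^ M else 0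
      _ ≤ _ := by
        rw [Finset.sum_const, nsmul_eq_mul, mul_comm]
        gcongr
        exact card_pos_hammingNorm_lt hα0 hα1 N
  · refine (Finset.sum_le_card_nsmul _ _ (collisionProb F γ ⌈α * N⌉₊ ^ M) fun θ hθ => ?_).trans ?_
    · simp only [Finset.mem_filter, not_lt] at hθ
      exact pow_le_pow_left₀ (hpos _) (collisionProb_le_of_le h0 h1 (Nat.ceil_le.2 hθ.2)) _
    · rw [nsmul_eq_mul]
      have := hpos ⌈α * N⌉₊
      gcongr
      exact (Finset.filter_subset _ _).trans (Finset.filter_subset _ _)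

end SparseMatrix

/-- Union bound over the values of a random variable with finite range. -/
theorem toReal_measure_le_sum {Ω β : Type*} [MeasurableSpace Ω] [Fintype β] (P : Measure Ω)
    (X : Ω → β) {f : β → ℝ} (hf : ∀ b, 0 ≤ f b) (hX : ∀ b, P {ω | X ω = b} = ENNReal.ofReal (f b))
    (s : Finset β) : (P {ω | X ω ∈ s}).toReal ≤ ∑ b ∈ s, f b := by
  refine ENNReal.toReal_le_of_le_ofReal (Finset.sum_nonneg fun b _ => hf b) ?_
  rw [ENNReal.ofReal_sum_of_nonneg fun b _ => hf b]
  have : {ω | X ω ∈ s} = ⋃ b ∈ s, {ω | X ω = b} := by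
    ext ω
    simp
  rw [this]
  exact (measure_biUnion_finset_le s _).trans (Finset.sum_le_sum fun b _ => (hX b).le)

theorem sum_notMem_le {β : Type*} [Fintype β] [DecidableEq β] {f : β → ℝ} (hf : ∑ b, f b = 1)
    {s : Finset β} {ε : ℝ} (hs : 1 - ε ≤ ∑ b ∈ s, f b) :
    ∑ b, (if b ∈ s then 0 else f b) ≤ ε := by
  have h := Finset.sum_add_sum_compl s f
  have h' : ∑ b, (if b ∈ s then 0 else f b) = ∑ b ∈ sᶜ, f b := by
    rw [Finset.sum_ite, Finset.sum_const_zero, zero_add]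
    congr 1
    ext
    simp
  linarith

/-- Finite-`N` content of the paper's Proposition 2 (upper bound on the MAP error
probability in the WN and NC cases): with source `Θ` of pmf `p`, communication noise
`U` of pmf `q`, and a sensing matrix `A` with iid entries (`0` with probability
`1 − γ`, each nonzero element with probability `γ/(Q−1)`), all mutually independent,
and typical sets `T_Θ`, `T_U` of probability at least `1 − ε`, the probability that
some `φ ≠ Θ` has posterior score `p(φ)·q(AΘ + U − Aφ) ≥ p(Θ)·q(U)` is at most
`|T_U|·(1−γ)^M·αN·2^{N·H₂(α)}·(Q−1)^{αN}
  + |T_Θ|·|T_U|·(Q⁻¹ + (1 − γ/(1−Q⁻¹))^{⌈αN⌉}(1 − Q⁻¹))^M + 2ε`. -/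
theorem stmt10 {F : Type*} [Field F] [Fintype F] [DecidableEq F]
    {Q : ℕ} (hQcard : Fintype.card F = Q) (hQ : 2 ≤ Q)
    {N M : ℕ} (hN : 1 ≤ N) (hM : 1 ≤ M)
    {γ : ℝ} (hγ0 : 0 < γ) (hγ1 : γ ≤ 1 - 1 / (Q : ℝ))
    {α : ℝ} (hα0 : 0 < α) (hα1 : α < 1 / 2)
    {ε : ℝ} (hε : 0 ≤ ε)
    {Ω : Type*} [MeasurableSpace Ω] (P : Measure Ω) [IsProbabilityMeasure P]
    (Θ : Ω → (Fin N → F)) (U : Ω → (Fin M → F))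
    (A : Ω → Matrix (Fin M) (Fin N) F)
    (p : (Fin N → F) → ℝ) (hp0 : ∀ θ, 0 ≤ p θ) (hp1 : ∑ θ, p θ = 1)
    (q : (Fin M → F) → ℝ) (hq0 : ∀ u, 0 ≤ q u) (hq1 : ∑ u, q u = 1)
    (hΘlaw : ∀ θ₀, P {ω | Θ ω = θ₀} = ENNReal.ofReal (p θ₀))
    (hUlaw : ∀ u₀, P {ω | U ω = u₀} = ENNReal.ofReal (q u₀))
    (hAlaw : ∀ A₀ : Matrix (Fin M) (Fin N) F,
      P {ω | A ω = A₀}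
        = ∏ i, ∏ j, ENNReal.ofReal (if A₀ i j = 0 then 1 - γ else γ / ((Q : ℝ) - 1)))
    (hindep : ∀ (θ₀ : Fin N → F) (u₀ : Fin M → F) (A₀ : Matrix (Fin M) (Fin N) F),
      P {ω | Θ ω = θ₀ ∧ U ω = u₀ ∧ A ω = A₀}
        = P {ω | Θ ω = θ₀} * P {ω | U ω = u₀} * P {ω | A ω = A₀})
    (TΘ : Finset (Fin N → F)) (TU : Finset (Fin M → F))
    (hTΘ : 1 - ε ≤ (P {ω | Θ ω ∈ TΘ}).toReal)
    (hTU : 1 - ε ≤ (P {ω | U ω ∈ TU}).toReal) :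
    (P {ω | ∃ φ : Fin N → F, φ ≠ Θ ω ∧
        p (Θ ω) * q (U ω) ≤ p φ * q (A ω *ᵥ Θ ω + U ω - A ω *ᵥ φ)}).toReal
      ≤ (TU.card : ℝ) * (1 - γ) ^ M * (α * N) * 2 ^ ((N : ℝ) * binEnt α)
            * ((Q : ℝ) - 1) ^ (α * N)
        + (TΘ.card : ℝ) * (TU.card : ℝ)
            * ((Q : ℝ)⁻¹ + (1 - γ / (1 - (Q : ℝ)⁻¹)) ^ (⌈α * N⌉₊) * (1 - (Q : ℝ)⁻¹)) ^ M
        + 2 * ε := by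
  classical
  subst hQcard
  have h1 : γ ≤ 1 - (Fintype.card F : ℝ)⁻¹ := by rwa [one_div] at hγ1
  have hγ : γ ≤ 1 := h1.trans (sub_le_self _ (by positivity))
  set a : Matrix (Fin M) (Fin N) F → ℝ := fun A => ∏ i, ∏ j, sparseMass F γ (A i j)
  have ha0 : ∀ A, 0 ≤ a A := fun A =>
    Finset.prod_nonneg fun i _ => Finset.prod_nonneg fun j _ => sparseMass_nonneg hγ0.le hγ _
  have ha1 : ∑ A, a A = 1 := sum_prod_prod_sparseMass γ M N
  have hAlaw' : ∀ A₀, P {ω | A ω = A₀} = ENNReal.ofReal (a A₀) := by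
    intro A₀
    rw [hAlaw]
    refine Eq.trans (Finset.prod_congr rfl fun i _ => ?_) (ENNReal.ofReal_prod_of_nonneg fun i _ =>
      Finset.prod_nonneg fun j _ => sparseMass_nonneg hγ0.le hγ _).symm
    exact (ENNReal.ofReal_prod_of_nonneg fun j _ => sparseMass_nonneg hγ0.le hγ _).symm
  have hjoint : ∀ b : (Fin N → F) × (Fin M → F) × Matrix (Fin M) (Fin N) F,
      P {ω | (Θ ω, U ω, A ω) = b} = ENNReal.ofReal (p b.1 * q b.2.1 * a b.2.2) := by
    rintro ⟨θ, u, B⟩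
    simp only [Prod.mk.injEq]
    rw [hindep, hΘlaw, hUlaw, hAlaw', ENNReal.ofReal_mul (mul_nonneg (hp0 _) (hq0 _)),
      ENNReal.ofReal_mul (hp0 _)]
  have hΘε := sum_notMem_le hp1 (hTΘ.trans (toReal_measure_le_sum P Θ hp0 hΘlaw TΘ))
  have hUε := sum_notMem_le hq1 (hTU.trans (toReal_measure_le_sum P U hq0 hUlaw TU))
  let bad : Finset ((Fin N → F) × (Fin M → F) × Matrix (Fin M) (Fin N) F) :=
    {b | ∃ φ : Fin N → F, φ ≠ b.1 ∧
      p b.1 * q b.2.1 ≤ p φ * q (b.2.2 *ᵥ b.1 + b.2.1 - b.2.2 *ᵥ φ)}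
  have hbad := toReal_measure_le_sum P (fun ω => (Θ ω, U ω, A ω))
    (fun b => mul_nonneg (mul_nonneg (hp0 b.1) (hq0 b.2.1)) (ha0 b.2.2)) hjoint bad
  simp only [bad, Finset.mem_filter, Finset.mem_univ, true_and] at hbad
  refine hbad.trans ?_
  have hpt : ∀ (θ : Fin N → F) (u : Fin M → F) (B : Matrix (Fin M) (Fin N) F),
      (if ∃ φ : Fin N → F, φ ≠ θ ∧ p θ * q u ≤ p φ * q (B *ᵥ θ + u - B *ᵥ φ)
        then p θ * q u * a B else 0) ≤
      (if θ ∈ TΘ then 0 else p θ) * q u * a B + p θ * (if u ∈ TU then 0 else q u) * a B +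
      (if θ ∈ TΘ then 1 else 0) * (if u ∈ TU then 1 else 0) *
        ∑ φ, (if φ ≠ θ then p φ * (a B * q (B *ᵥ (θ - φ) + u)) else 0) := by
    intro θ u B
    have hq' := hq0 u
    have hp' := hp0 θ
    have haB := ha0 B
    have hterm : ∀ φ, 0 ≤ if φ ≠ θ then p φ * (a B * q (B *ᵥ (θ - φ) + u)) else 0 := by
      intro φ
      split_ifs
      · exact mul_nonneg (hp0 _) (mul_nonneg haB (hq0 _))
      · exact le_rfl
    have hsum := Finset.sum_nonneg fun φ (_ : φ ∈ Finset.univ) => hterm φ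
    have hprod : 0 ≤ p θ * q u * a B := by positivity
    by_cases hθ : θ ∈ TΘ <;> by_cases hu : u ∈ TU <;>
      simp only [hθ, hu, if_true, if_false, zero_mul, mul_zero, zero_add, add_zero, one_mul]
    · split_ifs with h
      · obtain ⟨φ, hφ, hle⟩ := h
        refine le_trans ?_ (Finset.single_le_sum (fun φ _ => hterm φ) (Finset.mem_univ φ))
        have harg : B *ᵥ θ + u - B *ᵥ φ = B *ᵥ (θ - φ) + u := by
          rw [mulVec_sub]
          abel
        rw [harg] at hle
        rw [if_pos hφ]
        calc
          _ ≤ p φ * q (B *ᵥ (θ - φ) + u) * a B := by gcongr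
          _ = _ := by ring
      · exact hsum
    all_goals split_ifs <;> linarith
  rw [Finset.sum_filter, Fintype.sum_prod_type]
  simp_rw [Fintype.sum_prod_type]
  refine (Finset.sum_le_sum fun θ _ => Finset.sum_le_sum fun u _ => Finset.sum_le_sum fun B _ =>
    hpt θ u B).trans ?_
  simp only [Finset.sum_add_distrib, ← Finset.mul_sum, ← Finset.sum_mul, ha1, hp1, hq1, mul_one,
    one_mul]
  have hmain : ∑ θ, ∑ u, (if θ ∈ TΘ then (1 : ℝ) else 0) * (if u ∈ TU then 1 else 0) *
      ∑ B, ∑ φ, (if φ ≠ θ then p φ * (a B * q (B *ᵥ (θ - φ) + u)) else 0) ≤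
      (TU.card : ℝ) * ((1 - γ) ^ M * (α * N * 2 ^ ((N : ℝ) * binEnt α) *
        ((Fintype.card F : ℝ) - 1) ^ (α * N)) +
        TΘ.card * collisionProb F γ ⌈α * N⌉₊ ^ M) := by
    calc
      _ ≤ ∑ θ, ∑ u, (if θ ∈ TΘ then (1 : ℝ) else 0) * (if u ∈ TU then 1 else 0) *
          ∑ φ, (if φ ≠ θ then p φ * collisionProb F γ (hammingNorm (θ - φ)) ^ M else 0) := by
        gcongr with θ _ u
        rw [Finset.sum_comm]
        gcongr with φ
        split_ifs
        · rw [← Finset.mul_sum]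
          exact mul_le_mul_of_nonneg_left
            (sum_sparseMass_mul_pmf_le hγ0.le h1 hq0 hq1 (θ - φ) u) (hp0 φ)
        · simp
      _ = (TU.card : ℝ) * ∑ φ, p φ *
          ∑ θ ∈ TΘ with φ ≠ θ, collisionProb F γ (hammingNorm (θ - φ)) ^ M := by
        simp_rw [← Finset.sum_mul, ← Finset.mul_sum, Finset.sum_boole]
        simp only [Finset.filter_mem_eq_inter, Finset.univ_inter, Finset.sum_filter,
          ite_mul, one_mul, zero_mul, Finset.mul_sum, mul_ite, mul_zero]
        rw [Finset.sum_comm]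
        refine Finset.sum_congr rfl fun φ _ => ?_
        rw [← Finset.sum_subset (Finset.subset_univ TΘ) fun θ _ hθ => by simp [hθ]]
        exact Finset.sum_congr rfl fun θ hθ => by simp [hθ]
      _ ≤ (TU.card : ℝ) * ∑ φ, p φ * ((1 - γ) ^ M * (α * N * 2 ^ ((N : ℝ) * binEnt α) *
          ((Fintype.card F : ℝ) - 1) ^ (α * N)) +
          TΘ.card * collisionProb F γ ⌈α * N⌉₊ ^ M) := by
        gcongr with φ
        · exact hp0 φ
        · exact sum_collisionProb_le hγ0.le h1 hα0 hα1 M TΘ φ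
      _ = _ := by rw [← Finset.sum_mul, hp1, one_mul]
  have hfinal := add_le_add (add_le_add hΘε hUε) hmain
  unfold collisionProb at hfinal
  refine hfinal.trans (le_of_eq ?_)
  ring
end

section
/- Let 𝔽_Q be a finite field with Q ≥ 2 elements, let p_θ and p_u be probability mass functions on 𝔽_Q, let 0 < γ ≤ 1 − 1/Q and c > 0. Assume: (i) H(p_u) < log₂ Q; (ii) γ > 1 − 2^{−H(p_u)}; (iii) c > H(p_θ)/(log₂ Q − H(p_u)). For each N ≥ 1 set M = ⌈cN⌉ and let Θ ∈ 𝔽_Q^N have iid coordinates with pmf p_θ, U ∈ 𝔽_Q^M have iid coordinates with pmf p_u, and A be an M × N matrix with iid entries equal to 0 with probability 1 − γ and to each nonzero element of 𝔽_Q with probability γ/(Q−1), with Θ, U, A mutually independent. Let P_e(N) be the probability that there exists φ ∈ 𝔽_Q^N with φ ≠ Θ and ∏_{i=1}^N p_θ(φ_i) · ∏_{j=1}^M p_u((AΘ + U − Aφ)_j) ≥ ∏_{i=1}^N p_θ(Θ_i) · ∏_{j=1}^M p_u(U_j). Then P_e(N) → 0 as N → ∞. -/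
open Matrix
open scoped Classical

/-- Chernoff bound: under an iid law on a finite alphabet, the probability that a word has
likelihood below `exp (-n (h + ε))`, where `h` is the entropy in nats, decays geometrically. -/
theorem exists_tail_likelihood_le_pow {F : Type*} [Fintype F] (p : F → ℝ)
    (hp0 : ∀ x, 0 ≤ p x) (hp1 : ∑ x, p x = 1) (h : ℝ) (hh : h = -∑ x, p x * Real.log (p x))
    {ε : ℝ} (hε : 0 < ε) :
    ∃ r : ℝ, 0 ≤ r ∧ r < 1 ∧ ∀ n : ℕ,
      ∑ x : Fin n → F, (if ∏ i, p (x i) < Real.exp (-(n * (h + ε))) then ∏ i, p (x i) else 0)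
        ≤ r ^ n := by
  let f : ℝ → ℝ := fun s => ∑ x, p x * Real.exp (-s * (Real.log (p x) + (h + ε)))
  have hf0 : f 0 = 1 := by simp [f, hp1]
  have hder : HasDerivAt f (-ε) 0 := by
    have : HasDerivAt f (∑ x, p x * (Real.exp (-0 * (Real.log (p x) + (h + ε)))
        * (-1 * (Real.log (p x) + (h + ε))))) 0 := by
      refine HasDerivAt.fun_sum fun x _ => ?_
      exact (((hasDerivAt_neg (0 : ℝ)).mul_const _).exp).const_mul _
    convert this using 1
    have e : ∀ x, p x * (Real.exp (-0 * (Real.log (p x) + (h + ε)))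
        * (-1 * (Real.log (p x) + (h + ε)))) = -(p x * Real.log (p x)) - (h + ε) * p x := by
      intro x
      simp only [neg_zero, zero_mul, Real.exp_zero]
      ring
    simp only [e, Finset.sum_sub_distrib, Finset.sum_neg_distrib, ← Finset.mul_sum, hp1]
    rw [← hh]
    ring
  obtain ⟨s, hs0, hs1⟩ : ∃ s : ℝ, 0 < s ∧ f s < 1 := by
    have h1 := (hasDerivAt_iff_tendsto_slope.1 hder).mono_left
      (nhdsWithin_mono (0 : ℝ) (show Set.Ioi (0 : ℝ) ⊆ {0}ᶜ from fun x hx => ne_of_gt hx))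
    have h2 := h1.eventually (gt_mem_nhds (show -ε < 0 by linarith))
    obtain ⟨s, hs, hs0⟩ := (h2.and self_mem_nhdsWithin).exists
    have hs0' : (0 : ℝ) < s := hs0
    refine ⟨s, hs0', ?_⟩
    rw [slope_def_field, hf0, sub_zero, div_lt_iff₀ hs0'] at hs
    linarith
  refine ⟨f s, Finset.sum_nonneg fun x _ => mul_nonneg (hp0 x) (Real.exp_pos _).le, hs1, ?_⟩
  intro n
  rw [Fintype.sum_pow]
  refine Finset.sum_le_sum fun x _ => ?_
  have hnn : 0 ≤ ∏ i, p (x i) := Finset.prod_nonneg fun i _ => hp0 _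
  rw [Finset.prod_mul_distrib]
  split_ifs with hlt
  · rcases hnn.eq_or_lt with h0 | hpos
    · rw [← h0, zero_mul]
    refine le_mul_of_one_le_right hnn ?_
    rw [← Real.exp_sum, Real.one_le_exp_iff, ← Finset.mul_sum, Finset.sum_add_distrib,
      ← Real.log_prod (fun i _ hi => hpos.ne' (Finset.prod_eq_zero (Finset.mem_univ i) hi))]
    have := (Real.log_lt_iff_lt_exp hpos).2 hlt
    simp only [Finset.sum_const, Finset.card_univ, Fintype.card_fin, nsmul_eq_mul]
    nlinarith
  · exact mul_nonneg hnn (Finset.prod_nonneg fun i _ => (Real.exp_pos _).le)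

/-- If the iid entries of a row `a` are zero with probability `β` and uniform otherwise, then
`a ⬝ᵥ d` is zero with probability `β ^ k` and uniform otherwise, where `k` is the number of
nonzero entries of `d`. -/
theorem sum_prod_mul_indicator_dotProduct {F : Type*} [Field F] [Fintype F]
    [DecidableEq F] (β : ℝ) (w : F → ℝ)
    (hw : ∀ a, w a = β * (if a = 0 then 1 else 0) + (1 - β) / Fintype.card F) :
    ∀ (n : ℕ) (d : Fin n → F) (x : F),
      ∑ a : Fin n → F, (∏ i, w (a i)) * (if a ⬝ᵥ d = x then 1 else 0)
        = 1 / Fintype.card F + (∏ i, if d i = 0 then 1 else β)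
          * ((if x = 0 then 1 else 0) - 1 / Fintype.card F) := by
  have hQ : (Fintype.card F : ℝ) ≠ 0 := by exact_mod_cast Fintype.card_ne_zero
  have hw1 : ∑ a, w a = 1 := by
    simp only [hw, Finset.sum_add_distrib, ← Finset.mul_sum, Finset.sum_ite_eq', Finset.mem_univ,
      if_true, Finset.sum_const, Finset.card_univ, nsmul_eq_mul]
    field_simp
    ring
  intro n
  induction n with
  | zero =>
    intro d x
    simp [dotProduct, eq_comm]
  | succ n ih =>
    intro d x
    rw [← (Fin.consEquiv fun _ => F).sum_comp, Fintype.sum_prod_type]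
    have key : ∀ a₀ : F, ∑ a : Fin n → F, (∏ i, w ((Fin.consEquiv fun _ => F) (a₀, a) i))
        * (if (Fin.consEquiv fun _ => F) (a₀, a) ⬝ᵥ d = x then (1 : ℝ) else 0)
        = w a₀ * (1 / Fintype.card F + (∏ i : Fin n, if d i.succ = 0 then 1 else β)
          * ((if x - a₀ * d 0 = 0 then 1 else 0) - 1 / Fintype.card F)) := by
      intro a₀
      rw [← ih (fun i => d i.succ) (x - a₀ * d 0), Finset.mul_sum]
      refine Finset.sum_congr rfl fun a _ => ?_
      simp only [Fin.consEquiv_apply, Fin.prod_univ_succ, Fin.cons_zero, Fin.cons_succ, dotProduct,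
        Fin.sum_univ_succ, mul_assoc, eq_sub_iff_add_eq, add_comm]
    rw [Finset.sum_congr rfl fun a₀ _ => key a₀, Fin.prod_univ_succ]
    generalize (∏ i : Fin n, if d i.succ = 0 then 1 else β) = B
    by_cases hd : d 0 = 0
    · simp only [hd, mul_zero, sub_zero, if_true, one_mul, ← Finset.sum_mul, hw1]
    · have hsum : ∑ a₀, (if x - a₀ * d 0 = 0 then (1 : ℝ) else 0) = 1 := by
        have : ∀ a₀, (x - a₀ * d 0 = 0) ↔ (a₀ = x / d 0) := fun a₀ => by
          rw [sub_eq_zero, eq_div_iff hd, eq_comm]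
        simp [this]
      have hz : ∑ a₀ : F, (if a₀ = 0 then (1 : ℝ) else 0) * (if x - a₀ * d 0 = 0 then (1 : ℝ) else 0)
          = if x = 0 then 1 else 0 := by
        simp only [ite_mul, one_mul, zero_mul, Finset.sum_ite_eq', Finset.mem_univ, if_true,
          sub_zero]
      have hmix : ∑ a₀, w a₀ * (if x - a₀ * d 0 = 0 then (1 : ℝ) else 0)
          = β * (if x = 0 then 1 else 0) + (1 - β) / Fintype.card F := by
        simp only [hw, add_mul, Finset.sum_add_distrib, mul_assoc, ← Finset.mul_sum, hz, hsum,
          mul_one]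
      have e : ∀ a₀, w a₀ * (1 / (Fintype.card F : ℝ) + B * ((if x - a₀ * d 0 = 0 then 1 else 0)
          - 1 / Fintype.card F)) = w a₀ * (1 / (Fintype.card F : ℝ) - B * (1 / Fintype.card F))
            + B * (w a₀ * (if x - a₀ * d 0 = 0 then 1 else 0)) := fun a₀ => by ring
      simp only [e, Finset.sum_add_distrib, ← Finset.sum_mul, ← Finset.mul_sum, hmix, hw1]
      rw [if_neg hd]
      ring

/-- The law of `A *ᵥ d` for a matrix with iid rows is a product law. -/
theorem sum_prod_mul_indicator_mulVec {F : Type*} [Field F] [Fintype F]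
    [DecidableEq F] (w : F → ℝ) {m n : ℕ}
    (d : Fin n → F) (v : Fin m → F) :
    ∑ A : Matrix (Fin m) (Fin n) F,
        (∏ i, ∏ j, w (A i j)) * (if A *ᵥ d = v then (1 : ℝ) else 0)
      = ∏ i, ∑ a : Fin n → F, (∏ j, w (a j)) * (if a ⬝ᵥ d = v i then 1 else 0) := by
  rw [Finset.prod_univ_sum, Fintype.piFinset_univ]
  refine Finset.sum_congr rfl fun A _ => ?_
  rw [Finset.prod_mul_distrib, Finset.prod_boole]
  simp [funext_iff, mulVec]

/-- A word with positive likelihood is at most `K ^ k` times less likely than a word differing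
from it in `k` coordinates. -/
theorem prod_le_pow_card_mul_prod {F : Type*} [DecidableEq F] {n : ℕ} (p : F → ℝ)
    (hp0 : ∀ x, 0 ≤ p x) (hp1 : ∀ x, p x ≤ 1) {K : ℝ}
    (hK : ∀ x, 0 < p x → 1 ≤ K * p x) (θ φ : Fin n → F) (hθ : 0 < ∏ i, p (θ i)) :
    ∏ i, p (φ i) ≤ (∏ i, if φ i = θ i then 1 else K) * ∏ i, p (θ i) := by
  rw [← Finset.prod_mul_distrib]
  refine Finset.prod_le_prod (fun i _ => hp0 _) fun i _ => ?_
  split_ifs with h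
  · rw [h, one_mul]
  · have : p (θ i) ≠ 0 := fun hi => hθ.ne' (Finset.prod_eq_zero (Finset.mem_univ i) hi)
    exact (hp1 _).trans (hK _ (lt_of_le_of_ne (hp0 _) this.symm))

theorem sum_prod_ite_eq_pow {F : Type*} [Fintype F] [DecidableEq F] {n : ℕ} (z : ℝ) (θ : Fin n → F) :
    ∑ φ : Fin n → F, ∏ i, (if φ i = θ i then 1 else z)
      = (1 + ((Fintype.card F : ℝ) - 1) * z) ^ n := by
  have := Finset.prod_univ_sum (fun _ : Fin n => (Finset.univ : Finset F))
    (fun i a => if a = θ i then (1 : ℝ) else z)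
  rw [Fintype.piFinset_univ] at this
  rw [← this]
  have e : ∀ i, ∑ a, (if a = θ i then (1 : ℝ) else z) = 1 + ((Fintype.card F : ℝ) - 1) * z := by
    intro i
    have : ∀ a, (if a = θ i then (1 : ℝ) else z) = (if a = θ i then (1 - z) else 0) + z := by
      intro a; split_ifs <;> ring
    simp only [this, Finset.sum_add_distrib, Finset.sum_ite_eq', Finset.mem_univ, if_true,
      Finset.sum_const, Finset.card_univ, nsmul_eq_mul]
    ring
  simp [e]

theorem prod_ite_one_eq_pow_card {ι : Type*} [Fintype ι] (P : ι → Prop) [DecidablePred P] (b : ℝ) :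
    (∏ i, if P i then 1 else b) = b ^ (Finset.univ.filter fun i => ¬ P i).card := by
  rw [Finset.prod_ite]
  simp

/-- Union bound on the conditional error probability of MAP decoding given a source word and a
noise word of likelihood at least `T₁` and `T₂`. Candidates at Hamming distance at least `w₀`
contribute the first term, the others the second one. -/
theorem conditional_error_le {F : Type*} [Field F] [Fintype F]
    [DecidableEq F]
    (pθ pu : F → ℝ)
    (hpθ0 : ∀ x, 0 ≤ pθ x) (hpθ1 : ∑ x, pθ x = 1)
    (hpu0 : ∀ x, 0 ≤ pu x) (hpu1 : ∑ x, pu x = 1)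
    (w : F → ℝ) {β : ℝ} (hβ0 : 0 ≤ β) (hβ1 : β ≤ 1)
    (hw : ∀ a, w a = β * (if a = 0 then 1 else 0) + (1 - β) / Fintype.card F)
    {δ K z : ℝ} {w₀ : ℕ} (hδ : β ^ w₀ ≤ δ) (hK1 : 1 ≤ K) (hK : ∀ x, 0 < pθ x → 1 ≤ K * pθ x)
    (hz0 : 0 < z) (hz1 : z ≤ 1) {m n : ℕ} {T₁ T₂ : ℝ} (hT₁ : 0 < T₁) (hT₂ : 0 < T₂)
    (θ : Fin n → F) (u : Fin m → F) (hθ : T₁ ≤ ∏ i, pθ (θ i)) (hu : T₂ ≤ ∏ j, pu (u j)) :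
    ∑ A : Matrix (Fin m) (Fin n) F, (∏ i, ∏ j, w (A i j))
        * (if ∃ φ : Fin n → F, φ ≠ θ ∧ (∏ i, pθ (θ i)) * (∏ j, pu (u j))
              ≤ (∏ i, pθ (φ i)) * (∏ j, pu ((A *ᵥ θ + u - A *ᵥ φ) j)) then (1 : ℝ) else 0)
      ≤ (T₁ * T₂)⁻¹ * (1 / Fintype.card F + δ) ^ m
        + (K / z) ^ w₀ * (1 + ((Fintype.card F : ℝ) - 1) * z) ^ n * T₂⁻¹
          * (β + (1 - β) / Fintype.card F) ^ m := by
  set Q : ℝ := (Fintype.card F : ℝ) with hQdef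
  have hQ : 0 < Q := by rw [hQdef]; exact_mod_cast Fintype.card_pos
  have hQ1 : 1 ≤ Q := by rw [hQdef]; exact_mod_cast Nat.one_le_iff_ne_zero.2 Fintype.card_ne_zero
  have hQi : 1 / Q ≤ 1 := by rw [div_le_one hQ]; exact hQ1
  have hQi0 : 0 < 1 / Q := by positivity
  have hδ0 : 0 ≤ δ := (pow_nonneg hβ0 _).trans hδ
  have hw0 : ∀ a, 0 ≤ w a := fun a => by
    rw [hw]
    have : 0 ≤ (1 - β) / Q := div_nonneg (by linarith) hQ.le
    split_ifs <;> nlinarith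
  have hC0 : 0 ≤ β + (1 - β) / Q := add_nonneg hβ0 (div_nonneg (by linarith) hQ.le)
  have hPθ0 : ∀ x : Fin n → F, 0 ≤ ∏ i, pθ (x i) := fun x => Finset.prod_nonneg fun i _ => hpθ0 _
  have hPu0 : ∀ x : Fin m → F, 0 ≤ ∏ i, pu (x i) := fun x => Finset.prod_nonneg fun i _ => hpu0 _
  have hθpos := hT₁.trans_le hθ
  have hupos := hT₂.trans_le hu
  have hpθle : ∀ x, pθ x ≤ 1 := fun x => by
    rw [← hpθ1]; exact Finset.single_le_sum (fun y _ => hpθ0 y) (Finset.mem_univ x)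
  let G : (Fin n → F) → (Fin m → F) → Prop := fun φ v =>
    φ ≠ θ ∧ (∏ i, pθ (θ i)) * (∏ j, pu (u j)) ≤ (∏ i, pθ (φ i)) * (∏ j, pu (v j))
  have hunion : ∀ A : Matrix (Fin m) (Fin n) F,
      (if ∃ φ : Fin n → F, φ ≠ θ ∧ (∏ i, pθ (θ i)) * (∏ j, pu (u j))
          ≤ (∏ i, pθ (φ i)) * (∏ j, pu ((A *ᵥ θ + u - A *ᵥ φ) j)) then (1 : ℝ) else 0)
        ≤ ∑ φ : Fin n → F, ∑ v : Fin m → F, (if G φ v then (1 : ℝ) else 0)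
          * (if A *ᵥ (θ - φ) = v - u then 1 else 0) := by
    intro A
    have hnn : ∀ φ v, 0 ≤ (if G φ v then (1 : ℝ) else 0)
        * (if A *ᵥ (θ - φ) = v - u then 1 else 0) := fun φ v => by positivity
    split_ifs with hex
    · obtain ⟨φ, hφ⟩ := hex
      refine le_trans ?_ (Finset.single_le_sum
        (fun φ _ => Finset.sum_nonneg fun v _ => hnn φ v) (Finset.mem_univ φ))
      refine le_trans ?_ (Finset.single_le_sum
        (fun v _ => hnn φ v) (Finset.mem_univ (A *ᵥ θ + u - A *ᵥ φ)))
      rw [if_pos hφ, if_pos, mul_one]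
      rw [mulVec_sub]
      abel
    · exact Finset.sum_nonneg fun φ _ => Finset.sum_nonneg fun v _ => hnn φ v
  have hterm : ∀ (φ : Fin n → F) (v : Fin m → F), (if G φ v then (1 : ℝ) else 0)
      * ∑ A : Matrix (Fin m) (Fin n) F, (∏ i, ∏ j, w (A i j))
        * (if A *ᵥ (θ - φ) = v - u then 1 else 0)
      ≤ (∏ i, pθ (φ i)) * (∏ j, pu (v j)) * ((T₁ * T₂)⁻¹ * (1 / Q + δ) ^ m)
        + (∏ i, if φ i = θ i then 1 else z) * (∏ j, pu (v j))
          * ((K / z) ^ w₀ * T₂⁻¹ * (β + (1 - β) / Q) ^ m) := by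
    intro φ v
    have hI : (∏ i, if φ i = θ i then 1 else z)
        = z ^ (Finset.univ.filter fun i => ¬ φ i = θ i).card := prod_ite_one_eq_pow_card _ z
    have hn1 : 0 ≤ (∏ i, pθ (φ i)) * (∏ j, pu (v j)) * ((T₁ * T₂)⁻¹ * (1 / Q + δ) ^ m) := by
      have := hPθ0 φ
      have := hPu0 v
      positivity
    have hn2 : 0 ≤ (∏ i, if φ i = θ i then 1 else z) * (∏ j, pu (v j))
          * ((K / z) ^ w₀ * T₂⁻¹ * (β + (1 - β) / Q) ^ m) := by
      have := hPu0 v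
      rw [hI]
      positivity
    by_cases hG : G φ v
    swap
    · rw [if_neg hG, zero_mul]; exact add_nonneg hn1 hn2
    rw [if_pos hG, one_mul, sum_prod_mul_indicator_mulVec]
    obtain ⟨hne, hsc⟩ := hG
    simp only [sum_prod_mul_indicator_dotProduct β w hw, ← hQdef, Pi.sub_apply, sub_eq_zero,
      eq_comm (a := θ _)]
    have hB : (∏ i, if φ i = θ i then 1 else β)
        = β ^ (Finset.univ.filter fun i => ¬ φ i = θ i).card := prod_ite_one_eq_pow_card _ β
    have hKp := prod_le_pow_card_mul_prod pθ hpθ0 hpθle hK θ φ hθpos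
    rw [prod_ite_one_eq_pow_card] at hKp
    rw [hI] at hn2 ⊢
    rw [hB]
    set k := (Finset.univ.filter fun i => ¬ φ i = θ i).card with hk
    have hk1 : 1 ≤ k := by
      rw [hk, Nat.one_le_iff_ne_zero, Finset.card_ne_zero]
      obtain ⟨i, hi⟩ := Function.ne_iff.1 hne
      exact ⟨i, by simpa using hi⟩
    have hβk0 : 0 ≤ β ^ k := pow_nonneg hβ0 _
    have hβk1 : β ^ k ≤ 1 := pow_le_one₀ hβ0 hβ1
    have hfac0 : ∀ j, 0 ≤ 1 / Q + β ^ k * ((if v j = u j then 1 else 0) - 1 / Q) := by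
      intro j
      split_ifs <;> nlinarith
    have hfac : ∀ b, β ^ k ≤ b → ∀ j,
        1 / Q + β ^ k * ((if v j = u j then 1 else 0) - 1 / Q) ≤ 1 / Q + b * (1 - 1 / Q) := by
      intro b hb j
      split_ifs <;> nlinarith
    have hprod : ∀ b, β ^ k ≤ b →
        (∏ j, (1 / Q + β ^ k * ((if v j = u j then 1 else 0) - 1 / Q)))
          ≤ (1 / Q + b * (1 - 1 / Q)) ^ m := by
      intro b hb
      refine (Finset.prod_le_prod (fun j _ => hfac0 j) fun j _ => hfac b hb j).trans ?_
      simp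
    by_cases hkw : w₀ ≤ k
    · refine le_add_of_le_of_nonneg ?_ hn2
      have h1 := hprod δ ((pow_le_pow_of_le_one hβ0 hβ1 hkw).trans hδ)
      have h2 : (1 / Q + δ * (1 - 1 / Q)) ^ m ≤ (1 / Q + δ) ^ m := by
        apply pow_le_pow_left₀ <;> nlinarith
      have h3 : 1 ≤ (∏ i, pθ (φ i)) * (∏ j, pu (v j)) * (T₁ * T₂)⁻¹ := by
        rw [← div_eq_mul_inv, one_le_div (mul_pos hT₁ hT₂)]
        exact (mul_le_mul hθ hu hT₂.le hθpos.le).trans hsc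
      rw [← mul_assoc]
      exact (h1.trans h2).trans (le_mul_of_one_le_left (by positivity) h3)
    · refine le_add_of_nonneg_of_le hn1 ?_
      have h1 := hprod β (pow_le_of_le_one hβ0 hβ1 (by omega))
      have h2 : 1 / Q + β * (1 - 1 / Q) = β + (1 - β) / Q := by ring
      rw [h2] at h1
      have h3 : 1 ≤ z ^ k * (∏ j, pu (v j)) * ((K / z) ^ w₀ * T₂⁻¹) := by
        have hkw' : k ≤ w₀ := by omega
        have e1 : z ^ w₀ ≤ z ^ k := pow_le_pow_of_le_one hz0.le hz1 hkw'
        have e2 : K ^ k ≤ K ^ w₀ := pow_le_pow_right₀ hK1 hkw'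
        have e3 : ∏ j, pu (u j) ≤ K ^ k * ∏ j, pu (v j) := by
          refine le_of_mul_le_mul_left (a := ∏ i, pθ (θ i)) ?_ hθpos
          calc _ ≤ _ := hsc
            _ ≤ (K ^ k * ∏ i, pθ (θ i)) * ∏ j, pu (v j) :=
              mul_le_mul_of_nonneg_right hKp (hPu0 v)
            _ = _ := by ring
        have e4 : T₂ ≤ K ^ w₀ * ∏ j, pu (v j) :=
          (hu.trans e3).trans (mul_le_mul_of_nonneg_right e2 (hPu0 v))
        have e5 : z ^ k * (∏ j, pu (v j)) * ((K / z) ^ w₀ * T₂⁻¹)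
            = (z ^ k * (K ^ w₀ * ∏ j, pu (v j))) / (z ^ w₀ * T₂) := by
          rw [div_pow]; field_simp
        rw [e5, one_le_div (by positivity)]
        exact mul_le_mul e1 e4 hT₂.le (by positivity)
      rw [← mul_assoc]
      exact h1.trans (le_mul_of_one_le_left (by positivity) h3)
  calc _ ≤ ∑ A : Matrix (Fin m) (Fin n) F, (∏ i, ∏ j, w (A i j))
        * ∑ φ : Fin n → F, ∑ v : Fin m → F, (if G φ v then (1 : ℝ) else 0)
          * (if A *ᵥ (θ - φ) = v - u then 1 else 0) :=
        Finset.sum_le_sum fun A _ => mul_le_mul_of_nonneg_left (hunion A)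
          (Finset.prod_nonneg fun i _ => Finset.prod_nonneg fun j _ => hw0 _)
    _ = ∑ φ : Fin n → F, ∑ v : Fin m → F, (if G φ v then (1 : ℝ) else 0)
        * ∑ A : Matrix (Fin m) (Fin n) F, (∏ i, ∏ j, w (A i j))
          * (if A *ᵥ (θ - φ) = v - u then 1 else 0) := by
        simp only [Finset.mul_sum]
        rw [Finset.sum_comm]
        refine Finset.sum_congr rfl fun φ _ => ?_
        rw [Finset.sum_comm]
        exact Finset.sum_congr rfl fun v _ => Finset.sum_congr rfl fun A _ => by ring
    _ ≤ _ := Finset.sum_le_sum fun φ _ => Finset.sum_le_sum fun v _ => hterm φ v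
    _ = _ := by
        simp only [Finset.sum_add_distrib, ← Finset.sum_mul, ← Finset.mul_sum,
          ← Fintype.sum_pow, hpθ1, hpu1, one_pow, mul_one, one_mul, sum_prod_ite_eq_pow]
        ring

/-- The paper's Proposition 3 (sufficient condition for vanishing error probability
in the NC case, for the SI source model of iid coordinates): if the communication
noise is not uniform (`H(p_u) < log₂ Q`), the sparsity factor satisfies
`γ > 1 − 2^{−H(p_u)}`, and the compression ratio satisfies
`c > H(p_θ)/(log₂ Q − H(p_u))`, then with `M = ⌈cN⌉` the probability `P_e(N)` that
some `φ ≠ Θ` has posterior score at least that of `Θ` (written as an explicit finite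
sum over all realizations of the source `Θ`, the noise `U` and the iid sensing
matrix `A`) tends to `0` as `N → ∞`. -/
theorem stmt11 {F : Type*} [Field F] [Fintype F] [DecidableEq F]
    {Q : ℕ} (hQcard : Fintype.card F = Q) (hQ : 2 ≤ Q)
    (pθ pu : F → ℝ)
    (hpθ0 : ∀ x, 0 ≤ pθ x) (hpθ1 : ∑ x, pθ x = 1)
    (hpu0 : ∀ x, 0 ≤ pu x) (hpu1 : ∑ x, pu x = 1)
    (γ : ℝ) (hγ0 : 0 < γ) (hγ1 : γ ≤ 1 - 1 / (Q : ℝ))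
    (c : ℝ) (hc : 0 < c)
    (Hθ Hu : ℝ)
    (hHθ : Hθ = -∑ x, pθ x * Real.logb 2 (pθ x))
    (hHu : Hu = -∑ x, pu x * Real.logb 2 (pu x))
    (h1 : Hu < Real.logb 2 Q)
    (h2 : γ > 1 - 2 ^ (-Hu))
    (h3 : c > Hθ / (Real.logb 2 Q - Hu)) :
    Filter.Tendsto
      (fun N : ℕ =>
        ∑ θ : Fin N → F, ∑ u : Fin ⌈c * (N : ℝ)⌉₊ → F,
          ∑ A : Matrix (Fin ⌈c * (N : ℝ)⌉₊) (Fin N) F,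
            (∏ i, pθ (θ i)) * (∏ j, pu (u j))
              * (∏ i, ∏ j, (if A i j = 0 then 1 - γ else γ / ((Q : ℝ) - 1)))
              * (if ∃ φ : Fin N → F, φ ≠ θ ∧
                    (∏ i, pθ (θ i)) * (∏ j, pu (u j))
                      ≤ (∏ i, pθ (φ i)) * (∏ j, pu ((A *ᵥ θ + u - A *ᵥ φ) j))
                  then (1 : ℝ) else 0))
      Filter.atTop (nhds 0) := by
  have hQ' : (2 : ℝ) ≤ Q := by exact_mod_cast hQ
  have hQpos : (0 : ℝ) < Q := by linarith
  have hlog2 : 0 < Real.log 2 := Real.log_pos one_lt_two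
  have hentropy : ∀ p : F → ℝ, -∑ x, p x * Real.log (p x)
      = (-∑ x, p x * Real.logb 2 (p x)) * Real.log 2 := by
    intro p
    rw [neg_mul, Finset.sum_mul]
    congr 1
    refine Finset.sum_congr rfl fun x _ => ?_
    rw [mul_assoc, Real.logb, div_mul_cancel₀ _ hlog2.ne']
  set a := Hθ * Real.log 2 with ha
  set b := Hu * Real.log 2 with hb
  have ha' : a = -∑ x, pθ x * Real.log (pθ x) := by rw [hentropy, ← hHθ]
  have hb' : b = -∑ x, pu x * Real.log (pu x) := by rw [hentropy, ← hHu]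
  have ha0 : 0 ≤ a := by
    rw [ha', ← Finset.sum_neg_distrib]
    refine Finset.sum_nonneg fun x _ => ?_
    rw [← neg_mul]
    refine Real.negMulLog_nonneg (hpθ0 x) ?_
    rw [← hpθ1]
    exact Finset.single_le_sum (fun y _ => hpθ0 y) (Finset.mem_univ x)
  have hQ1 : (0 : ℝ) < (Q : ℝ) - 1 := by linarith
  -- Exponents of the contributions of far and near candidates.
  set g := (Real.log Q - b) - a / c with hg
  have hg0 : 0 < g := by
    have hgap : 0 < Real.logb 2 Q - Hu := by linarith
    have h4 := (div_lt_iff₀ hgap).1 h3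
    have h5 : a < c * (Real.log Q - b) := by
      have := mul_lt_mul_of_pos_right h4 hlog2
      have e : Real.logb 2 Q * Real.log 2 = Real.log Q := by
        rw [Real.logb, div_mul_cancel₀ _ hlog2.ne']
      calc a < c * (Real.logb 2 Q - Hu) * Real.log 2 := this
        _ = c * (Real.logb 2 Q * Real.log 2 - b) := by rw [hb]; ring
        _ = _ := by rw [e]
    rw [hg, sub_pos, div_lt_iff₀ hc]
    linarith
  have hγpos : 0 < 1 - γ := by
    have : 0 < 1 / (Q : ℝ) := by positivity
    linarith
  set g' := -b - Real.log (1 - γ) with hg'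
  have hg'0 : 0 < g' := by
    have h4 : 1 - γ < Real.exp (-b) := by
      have e : (2 : ℝ) ^ (-Hu) = Real.exp (-b) := by
        rw [Real.rpow_def_of_pos two_pos, hb]
        congr 1
        ring
      linarith
    have := (Real.log_lt_iff_lt_exp hγpos).2 h4
    linarith
  obtain ⟨ε, hε0, hε1, hε2⟩ : ∃ ε : ℝ, 0 < ε ∧ ε / c + ε < g / 2 ∧ ε < g' / 2 := by
    have hk : 0 < 1 / c + 1 := by positivity
    refine ⟨min (g / 4 / (1 / c + 1)) (g' / 4), by positivity, ?_, ?_⟩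
    · have h6 := mul_le_mul_of_nonneg_right (min_le_left (g / 4 / (1 / c + 1)) (g' / 4)) hk.le
      rw [div_mul_cancel₀ _ hk.ne'] at h6
      generalize min (g / 4 / (1 / c + 1)) (g' / 4) = ε at h6
      have : ε / c + ε = ε * (1 / c + 1) := by ring
      linarith
    · have := min_le_right (g / 4 / (1 / c + 1)) (g' / 4)
      linarith
  obtain ⟨z, hz0, hz1, hz2⟩ : ∃ z : ℝ, 0 < z ∧ z ≤ 1 ∧ ((Q : ℝ) - 1) * z / c < g' / 2 := by
    refine ⟨min 1 (g' / 4 * c / ((Q : ℝ) - 1)), by positivity, min_le_left _ _, ?_⟩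
    have h6 := min_le_right 1 (g' / 4 * c / ((Q : ℝ) - 1))
    generalize min 1 (g' / 4 * c / ((Q : ℝ) - 1)) = z at h6
    rw [le_div_iff₀ hQ1] at h6
    rw [div_lt_iff₀ hc]
    nlinarith
  obtain ⟨δ, hδ0, hδ⟩ : ∃ δ : ℝ, 0 < δ ∧ 1 / (Q : ℝ) + δ = Real.exp (g / 2 - Real.log Q) := by
    refine ⟨Real.exp (g / 2 - Real.log Q) - 1 / Q, ?_, by ring⟩
    rw [Real.exp_sub, Real.exp_log hQpos, sub_pos]
    refine div_lt_div_of_pos_right ?_ hQpos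
    rw [Real.one_lt_exp_iff]
    linarith
  obtain ⟨K, hK1, hK⟩ : ∃ K : ℝ, 1 ≤ K ∧ ∀ x, 0 < pθ x → 1 ≤ K * pθ x := by
    have hnn : ∀ x, 0 ≤ (pθ x)⁻¹ := fun x => inv_nonneg.2 (hpθ0 x)
    refine ⟨1 + ∑ x, (pθ x)⁻¹, le_add_of_nonneg_right (Finset.sum_nonneg fun x _ => hnn x), ?_⟩
    intro x hx
    have := Finset.single_le_sum (fun y _ => hnn y) (Finset.mem_univ x)
    calc 1 = (pθ x)⁻¹ * pθ x := (inv_mul_cancel₀ hx.ne').symm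
      _ ≤ _ := mul_le_mul_of_nonneg_right (by linarith) hx.le
  set β := 1 - γ * Q / ((Q : ℝ) - 1) with hβ
  have hβ0 : 0 ≤ β := by
    have : γ * Q ≤ (Q : ℝ) - 1 := by
      have := mul_le_mul_of_nonneg_right hγ1 hQpos.le
      have e : (1 - 1 / (Q : ℝ)) * Q = Q - 1 := by field_simp
      linarith
    rw [hβ, sub_nonneg, div_le_one hQ1]
    exact this
  have hβ1 : β < 1 := by
    have : 0 < γ * Q / ((Q : ℝ) - 1) := by positivity
    linarith
  have hβγ : β + (1 - β) / Q = 1 - γ := by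
    rw [hβ]; field_simp; ring
  obtain ⟨w₀, hw₀⟩ := exists_pow_lt_of_lt_one hδ0 hβ1
  set w : F → ℝ := fun x => if x = 0 then 1 - γ else γ / ((Q : ℝ) - 1) with hwdef
  have hw : ∀ x, w x = β * (if x = 0 then 1 else 0) + (1 - β) / Fintype.card F := by
    intro x
    rw [hQcard]
    simp only [hwdef]
    split_ifs
    · rw [mul_one, hβγ]
    · rw [hβ]; field_simp; ring
  have hw0 : ∀ x, 0 ≤ w x := by
    intro x
    simp only [hwdef]
    split_ifs
    · exact hγpos.le
    · positivity
  have hw1 : ∑ x, w x = 1 := by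
    simp only [hw, Finset.sum_add_distrib, ← Finset.mul_sum, Finset.sum_ite_eq', Finset.mem_univ,
      if_true, Finset.sum_const, Finset.card_univ, nsmul_eq_mul, hQcard]
    field_simp
    ring
  obtain ⟨r₁, hr₁0, hr₁1, hr₁⟩ := exists_tail_likelihood_le_pow pθ hpθ0 hpθ1 a ha' hε0
  obtain ⟨r₂, hr₂0, hr₂1, hr₂⟩ := exists_tail_likelihood_le_pow pu hpu0 hpu1 b hb' hε0
  set ρ₁ := Real.exp ((a + ε) / c + (b + ε) + (g / 2 - Real.log Q)) with hρ₁
  set ρ₂ := Real.exp (((Q : ℝ) - 1) * z / c + (b + ε) + Real.log (1 - γ)) with hρ₂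
  have hρ₁1 : ρ₁ < 1 := by
    rw [hρ₁, Real.exp_lt_one_iff, add_div]
    linarith
  have hρ₂1 : ρ₂ < 1 := by
    rw [hρ₂, Real.exp_lt_one_iff]
    linarith
  have hceil : Filter.Tendsto (fun N : ℕ => ⌈c * (N : ℝ)⌉₊) Filter.atTop Filter.atTop :=
    tendsto_nat_ceil_atTop.comp
      ((tendsto_natCast_atTop_atTop (R := ℝ)).const_mul_atTop hc)
  have hlim : Filter.Tendsto (fun N : ℕ => r₁ ^ N + r₂ ^ ⌈c * (N : ℝ)⌉₊
      + (ρ₁ ^ ⌈c * (N : ℝ)⌉₊ + (K / z) ^ w₀ * ρ₂ ^ ⌈c * (N : ℝ)⌉₊)) Filter.atTop (nhds 0) := by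
    have l1 := tendsto_pow_atTop_nhds_zero_of_lt_one hr₁0 hr₁1
    have l2 := (tendsto_pow_atTop_nhds_zero_of_lt_one hr₂0 hr₂1).comp hceil
    have l3 := (tendsto_pow_atTop_nhds_zero_of_lt_one (Real.exp_pos _).le hρ₁1).comp hceil
    have l4 := (tendsto_pow_atTop_nhds_zero_of_lt_one (Real.exp_pos _).le hρ₂1).comp hceil
    simpa using (l1.add l2).add (l3.add (l4.const_mul ((K / z) ^ w₀)))
  refine squeeze_zero (fun N => ?_) (fun N => ?_) hlim
  · refine Finset.sum_nonneg fun θ _ => Finset.sum_nonneg fun u _ =>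
      Finset.sum_nonneg fun A _ => ?_
    refine mul_nonneg (mul_nonneg (mul_nonneg (Finset.prod_nonneg fun i _ => hpθ0 _)
      (Finset.prod_nonneg fun i _ => hpu0 _))
      (Finset.prod_nonneg fun i _ => Finset.prod_nonneg fun j _ => hw0 _)) ?_
    split_ifs <;> norm_num
  have hm : c * (N : ℝ) ≤ ⌈c * (N : ℝ)⌉₊ := Nat.le_ceil _
  generalize ⌈c * (N : ℝ)⌉₊ = m at hm ⊢
  have hmN : (N : ℝ) ≤ m / c := by rw [le_div_iff₀ hc]; linarith
  set B := ρ₁ ^ m + (K / z) ^ w₀ * ρ₂ ^ m with hB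
  have hB0 : 0 ≤ B := by positivity
  have hbound : ((Real.exp (-(N * (a + ε))) * Real.exp (-(m * (b + ε))))⁻¹
        * (1 / Fintype.card F + δ) ^ m
        + (K / z) ^ w₀ * (1 + ((Fintype.card F : ℝ) - 1) * z) ^ N * (Real.exp (-(m * (b + ε))))⁻¹
          * (β + (1 - β) / Fintype.card F) ^ m) ≤ B := by
    rw [hQcard, hβγ, hδ, hB]
    refine add_le_add ?_ ?_
    · rw [← Real.exp_add, ← Real.exp_neg, ← Real.exp_nat_mul, ← Real.exp_add, hρ₁,
        ← Real.exp_nat_mul, Real.exp_le_exp]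
      have h6 := mul_le_mul_of_nonneg_right hmN (show 0 ≤ a + ε by linarith)
      have e : (m : ℝ) / c * (a + ε) = m * ((a + ε) / c) := by ring
      rw [e] at h6
      linarith
    · rw [mul_assoc, mul_assoc]
      refine mul_le_mul_of_nonneg_left ?_ (by positivity)
      have h7 : (1 + ((Q : ℝ) - 1) * z) ^ N ≤ Real.exp (((Q : ℝ) - 1) * z) ^ N := by
        refine pow_le_pow_left₀ (by positivity) ?_ _
        rw [add_comm]
        exact Real.add_one_le_exp _
      refine (mul_le_mul_of_nonneg_right h7 (by positivity)).trans ?_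
      rw [← Real.exp_neg, hρ₂, Real.exp_add _ (Real.log _), mul_pow, Real.exp_log hγpos, ← mul_assoc]
      refine mul_le_mul_of_nonneg_right ?_ (by positivity)
      rw [← Real.exp_nat_mul, ← Real.exp_nat_mul, ← Real.exp_add, Real.exp_le_exp]
      have h6 := mul_le_mul_of_nonneg_right hmN (show 0 ≤ ((Q : ℝ) - 1) * z by positivity)
      have e : (m : ℝ) / c * (((Q : ℝ) - 1) * z) = m * (((Q : ℝ) - 1) * z / c) := by ring
      rw [e] at h6
      linarith
  have hwsum : ∑ A : Matrix (Fin m) (Fin N) F, ∏ i, ∏ j, w (A i j) = 1 := by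
    have := Finset.prod_univ_sum (fun _ : Fin m => (Finset.univ : Finset (Fin N → F)))
      (fun _ x => ∏ j, w (x j))
    rw [Fintype.piFinset_univ] at this
    simp only [← Fintype.sum_pow, hw1, one_pow, Finset.prod_const_one] at this
    exact this.symm
  have hpoint : ∀ (θ : Fin N → F) (u : Fin m → F),
      ∑ A : Matrix (Fin m) (Fin N) F, (∏ i, pθ (θ i)) * (∏ j, pu (u j))
        * (∏ i, ∏ j, w (A i j))
        * (if ∃ φ : Fin N → F, φ ≠ θ ∧ (∏ i, pθ (θ i)) * (∏ j, pu (u j))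
              ≤ (∏ i, pθ (φ i)) * (∏ j, pu ((A *ᵥ θ + u - A *ᵥ φ) j)) then (1 : ℝ) else 0)
      ≤ (if ∏ i, pθ (θ i) < Real.exp (-(N * (a + ε))) then ∏ i, pθ (θ i) else 0) * (∏ j, pu (u j))
        + (∏ i, pθ (θ i))
          * (if ∏ i, pu (u i) < Real.exp (-(m * (b + ε))) then ∏ i, pu (u i) else 0)
        + (∏ i, pθ (θ i)) * (∏ j, pu (u j)) * B := by
    intro θ u
    have hθ0 : 0 ≤ ∏ i, pθ (θ i) := Finset.prod_nonneg fun i _ => hpθ0 _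
    have hu0 : 0 ≤ ∏ i, pu (u i) := Finset.prod_nonneg fun i _ => hpu0 _
    simp only [mul_assoc, ← Finset.mul_sum]
    simp only [← mul_assoc]
    set E := ∑ A : Matrix (Fin m) (Fin N) F, (∏ i, ∏ j, w (A i j))
        * (if ∃ φ : Fin N → F, φ ≠ θ ∧ (∏ i, pθ (θ i)) * (∏ j, pu (u j))
              ≤ (∏ i, pθ (φ i)) * (∏ j, pu ((A *ᵥ θ + u - A *ᵥ φ) j)) then (1 : ℝ) else 0)
      with hE
    have hE1 : E ≤ 1 := by
      rw [← hwsum]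
      refine Finset.sum_le_sum fun A _ => mul_le_of_le_one_right
        (Finset.prod_nonneg fun i _ => Finset.prod_nonneg fun j _ => hw0 _) ?_
      split_ifs <;> norm_num
    have hθu := mul_nonneg hθ0 hu0
    have hθuE := mul_le_of_le_one_right hθu hE1
    have hθuB := mul_nonneg hθu hB0
    by_cases hθ : ∏ i, pθ (θ i) < Real.exp (-(N * (a + ε)))
    · rw [if_pos hθ]
      have : 0 ≤ (∏ i, pθ (θ i))
          * (if ∏ i, pu (u i) < Real.exp (-(m * (b + ε))) then ∏ i, pu (u i) else 0) := by
        split_ifs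
        · exact hθu
        · simp
      linarith
    rw [if_neg hθ, zero_mul, zero_add]
    by_cases hu : ∏ i, pu (u i) < Real.exp (-(m * (b + ε)))
    · rw [if_pos hu]
      linarith
    rw [if_neg hu, mul_zero, zero_add]
    refine mul_le_mul_of_nonneg_left (le_trans ?_ hbound) hθu
    exact conditional_error_le pθ pu hpθ0 hpθ1 hpu0 hpu1 w hβ0 hβ1.le hw hw₀.le hK1 hK hz0 hz1
      (Real.exp_pos _) (Real.exp_pos _) θ u (not_lt.1 hθ) (not_lt.1 hu)
  refine (Finset.sum_le_sum fun θ _ => Finset.sum_le_sum fun u _ => hpoint θ u).trans ?_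
  simp only [Finset.sum_add_distrib, ← Finset.sum_mul, ← Finset.mul_sum, ← Fintype.sum_pow, hpθ1,
    hpu1, one_pow, mul_one, one_mul]
  linarith [hr₁ N, hr₂ m]
end

section
/- Let 𝔽_Q be a finite set with Q ≥ 2 elements, let p_Θ and p_u be probability mass functions on 𝔽_Q, and let R > 0. Define E₀ = inf over all pairs of probability mass functions (p, q) on 𝔽_Q of D(p ‖ p_Θ) + R·D(q ‖ p_u) + max{0, R·log₂ Q − H(p) − R·H(q)}, where D denotes base-2 Kullback–Leibler divergence (taken to be +∞ when p is not absolutely continuous with respect to p_Θ, and similarly for q). Then E₀ ≥ 0, and E₀ > 0 if and only if R·log₂ Q − H(p_Θ) − R·H(p_u) > 0. -/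
open scoped Classical ENNReal

/-- Base-2 Shannon entropy of a pmf on a finite set, with `0 · log₂ 0 = 0`
(automatic since `Real.logb 2 0 = 0`). -/
noncomputable def pmfEnt {F : Type*} [Fintype F] (p : F → ℝ) : ℝ :=
  -∑ x, p x * Real.logb 2 (p x)

/-- Base-2 Kullback–Leibler divergence between pmfs on a finite set, taken to be `∞`
when `p` is not absolutely continuous with respect to `r`. -/
noncomputable def klDiv2 {F : Type*} [Fintype F] (p r : F → ℝ) : ℝ≥0∞ :=
  if ∀ x, r x = 0 → p x = 0 then
    ENNReal.ofReal (∑ x, p x * Real.logb 2 (p x / r x))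
  else ⊤

/-- The set of probability mass functions on a finite set. -/
def isPmf {F : Type*} [Fintype F] (p : F → ℝ) : Prop :=
  (∀ x, 0 ≤ p x) ∧ ∑ x, p x = 1

theorem klDiv2_self {F : Type*} [Fintype F] (p : F → ℝ) : klDiv2 p p = 0 := by
  have h : ∀ x, p x * Real.logb 2 (p x / p x) = 0 := by
    intro x
    by_cases hx : p x = 0 <;> simp [hx]
  simp [klDiv2, h]

theorem continuous_pmfEnt {F : Type*} [Fintype F] :
    Continuous (pmfEnt : (F → ℝ) → ℝ) := by
  have h : (pmfEnt : (F → ℝ) → ℝ) =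
      fun p => -∑ x, p x * Real.log (p x) / Real.log 2 := by
    funext p
    simp only [pmfEnt, Real.logb, mul_div_assoc]
  rw [h]
  exact (continuous_finsetSum _ fun x _ =>
    (Real.continuous_mul_log.comp (continuous_apply x)).div_const _).neg

/-- The (unnormalized) squared Hellinger distance. -/
noncomputable def hellingerSq {F : Type*} [Fintype F] (p r : F → ℝ) : ℝ :=
  ∑ x, (√(p x) - √(r x)) ^ 2

theorem hellingerSq_nonneg {F : Type*} [Fintype F] (p r : F → ℝ) : 0 ≤ hellingerSq p r :=
  Finset.sum_nonneg fun _ _ => sq_nonneg _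

theorem continuous_hellingerSq {F : Type*} [Fintype F] (r : F → ℝ) :
    Continuous fun p : F → ℝ => hellingerSq p r := by
  unfold hellingerSq
  fun_prop

theorem eq_of_hellingerSq_eq_zero {F : Type*} [Fintype F] {p r : F → ℝ}
    (hp : ∀ x, 0 ≤ p x) (hr : ∀ x, 0 ≤ r x) (h : hellingerSq p r = 0) : p = r := by
  funext x
  have hx := (Finset.sum_eq_zero_iff_of_nonneg fun _ _ => sq_nonneg _).1 h x (Finset.mem_univ x)
  exact (Real.sqrt_inj (hp x) (hr x)).1 (sub_eq_zero.1 (pow_eq_zero_iff two_ne_zero |>.1 hx))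

theorem two_mul_sub_sqrt_mul_sqrt_le_mul_log_div {a b : ℝ} (ha : 0 ≤ a) (hb : 0 ≤ b)
    (hab : b = 0 → a = 0) : 2 * (a - √a * √b) ≤ a * Real.log (a / b) := by
  rcases ha.eq_or_lt with rfl | ha
  · simp
  have hb : 0 < b := hb.lt_of_ne' fun h => ha.ne' (hab h)
  have hlog := Real.log_le_sub_one_of_pos (div_pos (Real.sqrt_pos.2 hb) (Real.sqrt_pos.2 ha))
  rw [Real.log_div (Real.sqrt_pos.2 hb).ne' (Real.sqrt_pos.2 ha).ne', Real.log_sqrt hb.le,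
    Real.log_sqrt ha.le] at hlog
  rw [Real.log_div ha.ne' hb.ne']
  have hs : a * (√b / √a) = √a * √b := by
    have := (Real.sqrt_pos.2 ha).ne'
    field_simp
    rw [Real.sq_sqrt ha.le]
  nlinarith [mul_le_mul_of_nonneg_left hlog ha.le]

theorem ofReal_hellingerSq_div_log_two_le_klDiv2 {F : Type*} [Fintype F] {p r : F → ℝ}
    (hp : isPmf p) (hr : isPmf r) :
    ENNReal.ofReal (hellingerSq p r / Real.log 2) ≤ klDiv2 p r := by
  unfold klDiv2
  split_ifs with hac
  · apply ENNReal.ofReal_le_ofReal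
    have hsum : hellingerSq p r = ∑ x, 2 * (p x - √(p x) * √(r x)) := by
      have hterm : ∀ x, (√(p x) - √(r x)) ^ 2 =
          2 * (p x - √(p x) * √(r x)) + (r x - p x) := fun x => by
        rw [sub_sq, Real.sq_sqrt (hp.1 x), Real.sq_sqrt (hr.1 x)]
        ring
      simp only [hellingerSq, hterm, Finset.sum_add_distrib, Finset.sum_sub_distrib, hp.2, hr.2,
        sub_self, add_zero]
    simp only [Real.logb, ← mul_div_assoc, ← Finset.sum_div]
    rw [hsum]
    refine div_le_div_of_nonneg_right (Finset.sum_le_sum fun x _ => ?_) (Real.log_nonneg one_le_two)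
    exact two_mul_sub_sqrt_mul_sqrt_le_mul_log_div (hp.1 x) (hr.1 x) (hac x)
  · exact le_top

/-- Characterization of the positivity of the NC error exponent `E₀^{NC}` (eq. (cs1)
of the paper): with
`E₀ = inf_{p,q} D(p‖p_Θ) + R·D(q‖p_u) + max{0, R·log₂ Q − H(p) − R·H(q)}`,
one always has `E₀ ≥ 0`, and `E₀ > 0` iff `R·log₂ Q − H(p_Θ) − R·H(p_u) > 0`. -/
theorem stmt15 {F : Type*} [Fintype F] [Nonempty F]
    {Q : ℕ} (hQcard : Fintype.card F = Q) (hQ : 2 ≤ Q)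
    (pΘ pu : F → ℝ) (hpΘ : isPmf pΘ) (hpu : isPmf pu)
    (R : ℝ) (hR : 0 < R)
    (E₀ : ℝ≥0∞)
    (hE₀ : E₀ = ⨅ (p : F → ℝ) (_ : isPmf p) (q : F → ℝ) (_ : isPmf q),
        klDiv2 p pΘ + ENNReal.ofReal R * klDiv2 q pu
          + ENNReal.ofReal (R * Real.logb 2 Q - pmfEnt p - R * pmfEnt q)) :
    0 ≤ E₀ ∧ (0 < E₀ ↔ 0 < R * Real.logb 2 Q - pmfEnt pΘ - R * pmfEnt pu) := by
  subst hE₀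
  refine ⟨zero_le, fun h => ?_, fun h => ?_⟩
  · by_contra! hle
    refine h.not_ge ((iInf₂_le_of_le pΘ hpΘ (iInf₂_le_of_le pu hpu le_rfl)).trans ?_)
    simp [klDiv2_self, ENNReal.ofReal_of_nonpos hle]
  · have hlog : 0 < Real.log 2 := Real.log_pos one_lt_two
    let G : (F → ℝ) × (F → ℝ) → ℝ := fun z =>
      hellingerSq z.1 pΘ / Real.log 2 + R * (hellingerSq z.2 pu / Real.log 2)
        + max (R * Real.logb 2 Q - pmfEnt z.1 - R * pmfEnt z.2) 0
    have hG : Continuous G := by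
      have h1 := (continuous_hellingerSq pΘ).comp (continuous_fst (Y := F → ℝ))
      have h2 := (continuous_hellingerSq pu).comp (continuous_snd (X := F → ℝ))
      have h3 := continuous_pmfEnt.comp (continuous_fst (X := F → ℝ) (Y := F → ℝ))
      have h4 := continuous_pmfEnt.comp (continuous_snd (X := F → ℝ) (Y := F → ℝ))
      exact ((h1.div_const _).add ((h2.div_const _).const_mul R)).add
        (((continuous_const.sub h3).sub (h4.const_mul R)).max continuous_const)
    obtain ⟨z, hz, hmin⟩ :=
      ((isCompact_stdSimplex ℝ F).prod (isCompact_stdSimplex ℝ F)).exists_isMinOn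
        ⟨(pΘ, pu), hpΘ, hpu⟩ hG.continuousOn
    have hGz : 0 < G z := by
      have h1 : 0 ≤ hellingerSq z.1 pΘ / Real.log 2 :=
        div_nonneg (hellingerSq_nonneg _ _) hlog.le
      have h2 : 0 ≤ R * (hellingerSq z.2 pu / Real.log 2) :=
        mul_nonneg hR.le (div_nonneg (hellingerSq_nonneg _ _) hlog.le)
      have h3 := le_max_right (R * Real.logb 2 Q - pmfEnt z.1 - R * pmfEnt z.2) 0
      by_contra! hle
      simp only [G] at hle
      have e1 : hellingerSq z.1 pΘ / Real.log 2 = 0 := by linarith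
      have e2 : R * (hellingerSq z.2 pu / Real.log 2) = 0 := by linarith
      have e1 := eq_of_hellingerSq_eq_zero hz.1.1 hpΘ.1 (by simpa [hlog.ne'] using e1)
      have e2 := eq_of_hellingerSq_eq_zero hz.2.1 hpu.1 (by simpa [hlog.ne', hR.ne'] using e2)
      rw [e1, e2] at hle h3
      have := le_max_left (R * Real.logb 2 Q - pmfEnt pΘ - R * pmfEnt pu) 0
      rw [e1] at h1
      rw [e2] at h2
      linarith
    refine (ENNReal.ofReal_pos.2 hGz).trans_le
      (le_iInf₂ fun p hp => le_iInf₂ fun q hq => ?_)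
    have hle : G z ≤ G (p, q) := hmin (show (p, q) ∈ _ from ⟨hp, hq⟩)
    calc ENNReal.ofReal (G z) ≤ ENNReal.ofReal (G (p, q)) := ENNReal.ofReal_le_ofReal hle
      _ ≤ ENNReal.ofReal (hellingerSq p pΘ / Real.log 2)
          + ENNReal.ofReal R * ENNReal.ofReal (hellingerSq q pu / Real.log 2)
          + ENNReal.ofReal (R * Real.logb 2 Q - pmfEnt p - R * pmfEnt q) := by
        rw [← ENNReal.ofReal_mul hR.le]
        refine ENNReal.ofReal_add_le.trans (add_le_add ENNReal.ofReal_add_le ?_)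
        simp [ENNReal.ofReal_max]
      _ ≤ _ := by
        gcongr
        · exact ofReal_hellingerSq_div_log_two_le_klDiv2 hp hpΘ
        · exact ofReal_hellingerSq_div_log_two_le_klDiv2 hq hpu
end
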